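/- Let K ⊂ ℝ² be a compact strictly convex set with nonempty interior, C¹ boundary Γ = ∂K, and support function p with p' Lipschitz. Suppose there is an open interval J ⊂ ℝ of length less than 2π such that p is C² on an open neighborhood of the closure of J, the radius of curvature ρ = p + p'' is continuous there, ρ > 0 at both endpoints of J, and ρ(θ̂) = 0 for some θ̂ ∈ J. Then there exists ε > 0 such that no homotopically nontrivial Φ-invariant circle is contained in {z ∈ ℝ² ∖ K : dist(z, K) < ε}. -/

import Mathlib

open Real

noncomputable def suppFn (K : Set (ℝ × ℝ)) (θ : ℝ) : ℝ :=
  sSup ((fun z : ℝ × ℝ => z.1 * Real.cos θ + z.2 * Real.sin θ) '' K)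

def DBInvCircle (K : Set (ℝ × ℝ)) (Φ : ℝ × ℝ → ℝ × ℝ) (Ω : Set (ℝ × ℝ)) : Prop :=
  Ω ⊆ Kᶜ ∧ IsCompact Ω ∧ Φ '' Ω = Ω ∧
    ∃ ℓ : C(AddCircle (2 * Real.pi), (Kᶜ : Set (ℝ × ℝ))),
      Function.Injective ℓ ∧ ¬ ContinuousMap.Nullhomotopic ℓ ∧
      Ω = Subtype.val '' Set.range ℓ

open Filter Topology MeasureTheory

/-- The point at signed distance `l` from the contact point on the supporting line with outer
normal direction `θ`. -/
noncomputable def tangentPt (p : ℝ → ℝ) (θ l : ℝ) : ℝ × ℝ :=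
  (p θ * cos θ - (deriv p θ + l) * sin θ, p θ * sin θ + (deriv p θ + l) * cos θ)

/-- `p` is the support function of the compact convex body `K`, it is differentiable with Lipschitz
derivative, and every point outside `K` lies on a backward tangent ray. -/
structure SupportData (K : Set (ℝ × ℝ)) (p : ℝ → ℝ) : Prop where
  compact : IsCompact K
  convex : Convex ℝ K
  dot_le : ∀ k ∈ K, ∀ θ, k.1 * cos θ + k.2 * sin θ ≤ p θ
  exists_dot_lt : ∃ k ∈ interior K, ∀ θ, k.1 * cos θ + k.2 * sin θ < p θ
  exists_dot_eq : ∀ θ, ∃ k ∈ K, k.1 * cos θ + k.2 * sin θ = p θ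
  differentiable : Differentiable ℝ p
  lipschitz : ∃ L, LipschitzWith L (deriv p)
  periodic : Function.Periodic p (2 * π)
  exists_back : ∀ z ∉ K, ∃ θ l, 0 < l ∧ z = tangentPt p θ (-l)

/-- Distance from the intersection of the tangents at `θ₀` and `θ₁` to the contact point at `θ₁`. -/
noncomputable def backLen (p : ℝ → ℝ) (θ₀ θ₁ : ℝ) : ℝ :=
  (p θ₀ - p θ₁ * cos (θ₁ - θ₀) + deriv p θ₁ * sin (θ₁ - θ₀)) / sin (θ₁ - θ₀)

/-- Distance from the contact point at `θ₀` to the intersection of the tangents at `θ₀`, `θ₁`. -/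
noncomputable def fwdLen (p : ℝ → ℝ) (θ₀ θ₁ : ℝ) : ℝ :=
  (p θ₁ - p θ₀ * cos (θ₁ - θ₀) - deriv p θ₀ * sin (θ₁ - θ₀)) / sin (θ₁ - θ₀)

theorem tangentPt_dot (p : ℝ → ℝ) (θ l φ : ℝ) :
    (tangentPt p θ l).1 * cos φ + (tangentPt p θ l).2 * sin φ =
      p θ * cos (φ - θ) + (deriv p θ + l) * sin (φ - θ) := by
  simp only [tangentPt, cos_sub, sin_sub]; ring

theorem prod_ext_of_dot_eq {v w : ℝ × ℝ} {θ φ : ℝ} (h : sin (φ - θ) ≠ 0)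
    (hθ : v.1 * cos θ + v.2 * sin θ = w.1 * cos θ + w.2 * sin θ)
    (hφ : v.1 * cos φ + v.2 * sin φ = w.1 * cos φ + w.2 * sin φ) : v = w := by
  rw [sin_sub] at h
  apply Prod.ext
  · apply mul_right_cancel₀ h; linear_combination sin φ * hθ - sin θ * hφ
  · apply mul_right_cancel₀ h; linear_combination cos θ * hφ - cos φ * hθ

theorem tangentPt_fwdLen_eq (p : ℝ → ℝ) {θ₀ θ₁ : ℝ} (h : sin (θ₁ - θ₀) ≠ 0) :
    tangentPt p θ₀ (fwdLen p θ₀ θ₁) = tangentPt p θ₁ (-backLen p θ₀ θ₁) := by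
  have h' : sin (θ₀ - θ₁) = - sin (θ₁ - θ₀) := by rw [← sin_neg]; ring_nf
  have h'' : cos (θ₀ - θ₁) = cos (θ₁ - θ₀) := by rw [← cos_neg]; ring_nf
  apply prod_ext_of_dot_eq h <;> simp only [tangentPt_dot, sub_self, cos_zero, sin_zero, h', h'']
  · rw [backLen]; field_simp; ring
  · rw [fwdLen]; field_simp; ring

theorem sin_sub_pos {a b : ℝ} (h : a < b) (h' : b < a + π) : 0 < sin (b - a) :=
  sin_pos_of_pos_of_lt_pi (by linarith) (by linarith)

theorem continuous_tangentPt {p : ℝ → ℝ} (hp : Continuous p) (hp' : Continuous (deriv p)) :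
    Continuous fun q : ℝ × ℝ => tangentPt p q.1 q.2 := by
  unfold tangentPt; fun_prop

theorem continuousAt_backLen {p : ℝ → ℝ} (hp : Continuous p) (hp' : Continuous (deriv p))
    {q : ℝ × ℝ} (h : sin (q.2 - q.1) ≠ 0) :
    ContinuousAt (fun q : ℝ × ℝ => backLen p q.1 q.2) q := by
  unfold backLen
  exact ContinuousAt.div (by fun_prop) (by fun_prop) h

theorem continuousAt_fwdLen {p : ℝ → ℝ} (hp : Continuous p) (hp' : Continuous (deriv p))
    {q : ℝ × ℝ} (h : sin (q.2 - q.1) ≠ 0) :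
    ContinuousAt (fun q : ℝ × ℝ => fwdLen p q.1 q.2) q := by
  unfold fwdLen
  exact ContinuousAt.div (by fun_prop) (by fun_prop) h

theorem eq_tangentPt_of_isContact {p : ℝ → ℝ} {k : ℝ × ℝ} {θ : ℝ} (hp : DifferentiableAt ℝ p θ)
    (hle : ∀ φ, k.1 * cos φ + k.2 * sin φ ≤ p φ) (h : k.1 * cos θ + k.2 * sin θ = p θ) :
    k = tangentPt p θ 0 := by
  have hd : HasDerivAt (fun φ => p φ - (k.1 * cos φ + k.2 * sin φ))
      (deriv p θ - (k.1 * (-sin θ) + k.2 * cos θ)) θ :=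
    hp.hasDerivAt.sub (((hasDerivAt_cos θ).const_mul _).add ((hasDerivAt_sin θ).const_mul _))
  have hmin : IsLocalMin (fun φ => p φ - (k.1 * cos φ + k.2 * sin φ)) θ := by
    refine Filter.Eventually.of_forall fun φ => ?_
    have := hle φ
    simp only [h]; linarith
  have h0 := hmin.hasDerivAt_eq_zero hd
  have hsc := sin_sq_add_cos_sq θ
  apply Prod.ext <;> simp only [tangentPt]
  · linear_combination (-k.1) * hsc + cos θ * h + sin θ * h0
  · linear_combination (-k.2) * hsc + sin θ * h - cos θ * h0

namespace SupportData

variable {K : Set (ℝ × ℝ)} {p : ℝ → ℝ}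

theorem continuous_deriv (S : SupportData K p) : Continuous (deriv p) := by
  obtain ⟨L, hL⟩ := S.lipschitz
  exact hL.continuous

theorem eq_tangentPt_of_dot_eq (S : SupportData K p) {k : ℝ × ℝ} (hk : k ∈ K) {θ : ℝ}
    (h : k.1 * cos θ + k.2 * sin θ = p θ) : k = tangentPt p θ 0 :=
  eq_tangentPt_of_isContact (S.differentiable θ) (S.dot_le k hk) h

theorem tangentPt_zero_mem (S : SupportData K p) (θ : ℝ) : tangentPt p θ 0 ∈ K := by
  obtain ⟨k, hk, h⟩ := S.exists_dot_eq θ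
  exact S.eq_tangentPt_of_dot_eq hk h ▸ hk

theorem support_le (S : SupportData K p) (θ φ : ℝ) :
    p θ * cos (φ - θ) + deriv p θ * sin (φ - θ) ≤ p φ := by
  have := S.dot_le _ (S.tangentPt_zero_mem θ) φ
  rwa [tangentPt_dot, add_zero] at this

theorem tangentPt_eq_zero_iff (p : ℝ → ℝ) {θ l : ℝ} (h : tangentPt p θ l = tangentPt p θ 0) :
    l = 0 := by
  have h1 := congrArg Prod.fst h
  have h2 := congrArg Prod.snd h
  simp only [tangentPt] at h1 h2
  have hsc := sin_sq_add_cos_sq θ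
  linear_combination (-l) * hsc + cos θ * h2 - sin θ * h1

theorem tangentPt_notMem (S : SupportData K p) {θ l : ℝ} (hl : l ≠ 0) : tangentPt p θ l ∉ K :=
  fun h => hl <| tangentPt_eq_zero_iff p <| S.eq_tangentPt_of_dot_eq h <| by
    rw [tangentPt_dot]; simp

theorem fwdLen_nonneg (S : SupportData K p) {θ₀ θ₁ : ℝ} (h : 0 < sin (θ₁ - θ₀)) :
    0 ≤ fwdLen p θ₀ θ₁ :=
  div_nonneg (by linarith [S.support_le θ₀ θ₁]) h.le

theorem backLen_nonneg (S : SupportData K p) {θ₀ θ₁ : ℝ} (h : 0 < sin (θ₁ - θ₀)) :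
    0 ≤ backLen p θ₀ θ₁ := by
  have h' : sin (θ₀ - θ₁) = - sin (θ₁ - θ₀) := by rw [← sin_neg]; ring_nf
  have h'' : cos (θ₀ - θ₁) = cos (θ₁ - θ₀) := by rw [← cos_neg]; ring_nf
  have := S.support_le θ₁ θ₀
  rw [h', h''] at this
  exact div_nonneg (by linarith) h.le

theorem fwdLen_pos_iff (S : SupportData K p) {θ₀ θ₁ : ℝ} (h : 0 < sin (θ₁ - θ₀)) :
    0 < fwdLen p θ₀ θ₁ ↔ 0 < backLen p θ₀ θ₁ := by
  have e := tangentPt_fwdLen_eq p h.ne'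
  constructor <;> intro h1
  · refine (S.backLen_nonneg h).lt_of_ne fun h0 => S.tangentPt_notMem (θ := θ₀) h1.ne' ?_
    rw [e, ← h0, neg_zero]; exact S.tangentPt_zero_mem _
  · refine (S.fwdLen_nonneg h).lt_of_ne fun h0 =>
      S.tangentPt_notMem (θ := θ₁) (neg_ne_zero.2 h1.ne') ?_
    rw [← e, ← h0]; exact S.tangentPt_zero_mem _

/-- Membership of the backward tangent ray in a supporting half-plane. -/
theorem le_backLen_iff (p : ℝ → ℝ) {θ₀ θ₁ s : ℝ} (h : 0 < sin (θ₁ - θ₀)) :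
    s ≤ backLen p θ₀ θ₁ ↔
      (tangentPt p θ₁ (-s)).1 * cos θ₀ + (tangentPt p θ₁ (-s)).2 * sin θ₀ ≤ p θ₀ := by
  have h' : sin (θ₀ - θ₁) = - sin (θ₁ - θ₀) := by rw [← sin_neg]; ring_nf
  have h'' : cos (θ₀ - θ₁) = cos (θ₁ - θ₀) := by rw [← cos_neg]; ring_nf
  rw [tangentPt_dot, backLen, le_div_iff₀ h, h', h'']
  constructor <;> intro <;> linarith

theorem le_fwdLen_iff (p : ℝ → ℝ) {θ₀ θ₁ s : ℝ} (h : 0 < sin (θ₁ - θ₀)) :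
    s ≤ fwdLen p θ₀ θ₁ ↔
      (tangentPt p θ₀ s).1 * cos θ₁ + (tangentPt p θ₀ s).2 * sin θ₁ ≤ p θ₁ := by
  rw [tangentPt_dot, fwdLen, le_div_iff₀ h]
  constructor <;> intro <;> linarith

theorem backLen_anti (S : SupportData K p) {θ₀ θ₀' θ₁ : ℝ} (h : θ₁ - π < θ₀) (h' : θ₀ ≤ θ₀')
    (h'' : θ₀' < θ₁) : backLen p θ₀' θ₁ ≤ backLen p θ₀ θ₁ := by
  rcases h'.eq_or_lt with rfl | h'
  · rfl
  have h1 := sin_sub_pos (h'.trans h'') (by linarith)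
  have h2 := sin_sub_pos h'' (by linarith)
  have h3 := sin_sub_pos h' (by linarith)
  rw [le_backLen_iff p h1, ← tangentPt_fwdLen_eq p h2.ne', tangentPt_dot]
  have e : sin (θ₀ - θ₀') = - sin (θ₀' - θ₀) := by rw [← sin_neg]; ring_nf
  nlinarith [S.support_le θ₀' θ₀, mul_nonneg (S.fwdLen_nonneg h2) h3.le]

theorem fwdLen_mono (S : SupportData K p) {θ₀ θ₁ θ₁' : ℝ} (h : θ₀ < θ₁) (h' : θ₁ ≤ θ₁')
    (h'' : θ₁' < θ₀ + π) : fwdLen p θ₀ θ₁ ≤ fwdLen p θ₀ θ₁' := by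
  rcases h'.eq_or_lt with rfl | h'
  · rfl
  have h1 := sin_sub_pos (h.trans h') h''
  have h2 := sin_sub_pos h (by linarith)
  have h3 := sin_sub_pos h' (by linarith)
  rw [le_fwdLen_iff p h1, tangentPt_fwdLen_eq p h2.ne', tangentPt_dot]
  nlinarith [S.support_le θ₁ θ₁', mul_nonneg (S.backLen_nonneg h2) h3.le]

theorem cos_eq_one_of_tangentPt_eq (S : SupportData K p) {ε θ θ' l l' : ℝ}
    (hε : ε = 1 ∨ ε = -1) (hl : 0 < l) (hl' : 0 < l')
    (e : tangentPt p θ (ε * l) = tangentPt p θ' (ε * l')) : cos (θ' - θ) = 1 := by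
  have h' : sin (θ - θ') = - sin (θ' - θ) := by rw [← sin_neg]; ring_nf
  have h'' : cos (θ - θ') = cos (θ' - θ) := by rw [← cos_neg]; ring_nf
  have e1 := tangentPt_dot p θ (ε * l) θ'
  have e2 := tangentPt_dot p θ' (ε * l') θ
  rw [e, tangentPt_dot, sub_self, cos_zero, sin_zero] at e1
  rw [← e, tangentPt_dot, sub_self, cos_zero, sin_zero, h', h''] at e2
  have s1 := S.support_le θ θ'
  have s2 := S.support_le θ' θ
  rw [h', h''] at s2
  have a1 : 0 ≤ l * (ε * sin (θ' - θ)) := by linarith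
  have a2 : 0 ≤ l' * -(ε * sin (θ' - θ)) := by linarith
  have b1 := nonneg_of_mul_nonneg_right a1 hl
  have b2 := nonneg_of_mul_nonneg_right a2 hl'
  have h0 : sin (θ' - θ) = 0 := by
    rcases hε with rfl | rfl <;> linarith
  rcases sin_eq_zero_iff_cos_eq.1 h0 with h | h
  · exact h
  exfalso
  obtain ⟨k, -, hk⟩ := S.exists_dot_lt
  have c1 : cos θ' = - cos θ := by
    have : cos (θ + (θ' - θ)) = _ := cos_add _ _
    rw [h, h0] at this; rw [← add_sub_cancel θ θ', this]; ring
  have c2 : sin θ' = - sin θ := by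
    have : sin (θ + (θ' - θ)) = _ := sin_add _ _
    rw [h, h0] at this; rw [← add_sub_cancel θ θ', this]; ring
  have k1 := hk θ
  have k2 := hk θ'
  rw [c1, c2] at k2
  rw [h, h0] at e1
  linarith

theorem tangentPt_add_int (S : SupportData K p) (θ l : ℝ) (n : ℤ) :
    tangentPt p (θ + n * (2 * π)) l = tangentPt p θ l := by
  have h : deriv p (θ + n * (2 * π)) = deriv p θ := by
    rw [← deriv_comp_add_const]
    congr 1; ext x; exact S.periodic.int_mul n x
  simp [tangentPt, h, S.periodic.int_mul n θ, cos_add_int_mul_two_pi, sin_add_int_mul_two_pi]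

theorem tangentPt_inj_mod (S : SupportData K p) {ε θ θ' l l' : ℝ}
    (hε : ε = 1 ∨ ε = -1) (hl : 0 < l) (hl' : 0 < l')
    (e : tangentPt p θ (ε * l) = tangentPt p θ' (ε * l')) :
    (∃ n : ℤ, θ' = θ + n * (2 * π)) ∧ l = l' := by
  obtain ⟨n, hn⟩ := (cos_eq_one_iff _).1 (S.cos_eq_one_of_tangentPt_eq hε hl hl' e)
  have h1 : θ' = θ + n * (2 * π) := by linarith
  refine ⟨⟨n, h1⟩, ?_⟩
  rw [h1, S.tangentPt_add_int] at e
  have a := congrArg Prod.fst e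
  have b := congrArg Prod.snd e
  simp only [tangentPt] at a b
  have hsc := sin_sq_add_cos_sq θ
  have : ε * l = ε * l' := by
    linear_combination (-(ε * l) + ε * l') * hsc + cos θ * b - sin θ * a
  rcases hε with rfl | rfl <;> linarith

theorem exists_fwd_of_back (S : SupportData K p) {θ l : ℝ} (hl : 0 < l) :
    ∃ θ₀, θ - π < θ₀ ∧ θ₀ < θ ∧ 0 < fwdLen p θ₀ θ ∧ backLen p θ₀ θ = l := by
  have hc : Continuous fun s : ℝ => p (θ - s) - (p θ * cos s + (l - deriv p θ) * sin s) := by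
    have := S.differentiable.continuous
    fun_prop
  have hder : HasDerivAt (fun s : ℝ => p (θ - s) - (p θ * cos s + (l - deriv p θ) * sin s))
      (-l) 0 := by
    have h1 : HasDerivAt (fun s : ℝ => p (θ - s)) (deriv p θ * (-1)) 0 := by
      have h2 : HasDerivAt p (deriv p θ) (θ - 0) := by
        rw [sub_zero]; exact (S.differentiable θ).hasDerivAt
      exact h2.comp 0 ((hasDerivAt_id 0).const_sub θ)
    refine (h1.sub (((hasDerivAt_cos 0).const_mul (p θ)).add
      ((hasDerivAt_sin 0).const_mul (l - deriv p θ)))).congr_deriv ?_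
    simp; ring
  have hneg : ∀ᶠ s in nhdsWithin (0 : ℝ) (Set.Ioi 0),
      p (θ - s) - (p θ * cos s + (l - deriv p θ) * sin s) < 0 := by
    have := (hder.tendsto_slope.mono_left
      (nhdsWithin_mono 0 (fun x (hx : 0 < x) => hx.ne'))).eventually_lt_const
      (show -l < 0 by linarith)
    filter_upwards [this, self_mem_nhdsWithin] with s hs (hs0 : 0 < s)
    rw [slope_def_field] at hs
    simp only [sub_zero, cos_zero, sin_zero, mul_one, mul_zero, add_zero, sub_self] at hs
    rwa [div_lt_iff₀ hs0, zero_mul] at hs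
  obtain ⟨s, hs, hs0, hsπ⟩ := (hneg.and (Ioo_mem_nhdsGT pi_pos)).exists
  have hπ : 0 < p (θ - π) - (p θ * cos π + (l - deriv p θ) * sin π) := by
    obtain ⟨k, -, hk⟩ := S.exists_dot_lt
    have k1 := hk θ
    have k2 := hk (θ - π)
    rw [cos_sub_pi, sin_sub_pi] at k2
    rw [cos_pi, sin_pi]; linarith
  obtain ⟨t, ⟨ht1, ht2⟩, ht⟩ := intermediate_value_Ioo hsπ.le hc.continuousOn ⟨hs, hπ⟩
  have hsin : 0 < sin t := sin_pos_of_pos_of_lt_pi (hs0.trans ht1) ht2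
  have hb : backLen p (θ - t) θ = l := by
    rw [backLen, sub_sub_cancel, div_eq_iff hsin.ne']; linarith
  refine ⟨θ - t, by linarith, by linarith, ?_, hb⟩
  rw [S.fwdLen_pos_iff (by rwa [sub_sub_cancel]), hb]
  exact hl

theorem exists_back_of_fwd (S : SupportData K p) {θ m : ℝ} (hm : 0 < m) :
    ∃ θ₁, θ < θ₁ ∧ θ₁ < θ + π ∧ 0 < backLen p θ θ₁ ∧ fwdLen p θ θ₁ = m := by
  have hc : Continuous fun s : ℝ => p (θ + s) - (p θ * cos s + (m + deriv p θ) * sin s) := by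
    have := S.differentiable.continuous
    fun_prop
  have hder : HasDerivAt (fun s : ℝ => p (θ + s) - (p θ * cos s + (m + deriv p θ) * sin s))
      (-m) 0 := by
    have h1 : HasDerivAt (fun s : ℝ => p (θ + s)) (deriv p θ * 1) 0 := by
      have h2 : HasDerivAt p (deriv p θ) (θ + 0) := by
        rw [add_zero]; exact (S.differentiable θ).hasDerivAt
      exact h2.comp 0 ((hasDerivAt_id 0).const_add θ)
    refine (h1.sub (((hasDerivAt_cos 0).const_mul (p θ)).add
      ((hasDerivAt_sin 0).const_mul (m + deriv p θ)))).congr_deriv ?_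
    simp
  have hneg : ∀ᶠ s in nhdsWithin (0 : ℝ) (Set.Ioi 0),
      p (θ + s) - (p θ * cos s + (m + deriv p θ) * sin s) < 0 := by
    have := (hder.tendsto_slope.mono_left
      (nhdsWithin_mono 0 (fun x (hx : 0 < x) => hx.ne'))).eventually_lt_const
      (show -m < 0 by linarith)
    filter_upwards [this, self_mem_nhdsWithin] with s hs (hs0 : 0 < s)
    rw [slope_def_field] at hs
    simp only [sub_zero, cos_zero, sin_zero, mul_one, mul_zero, add_zero, sub_self] at hs
    rwa [div_lt_iff₀ hs0, zero_mul] at hs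
  obtain ⟨s, hs, hs0, hsπ⟩ := (hneg.and (Ioo_mem_nhdsGT pi_pos)).exists
  have hπ : 0 < p (θ + π) - (p θ * cos π + (m + deriv p θ) * sin π) := by
    obtain ⟨k, -, hk⟩ := S.exists_dot_lt
    have k1 := hk θ
    have k2 := hk (θ + π)
    rw [cos_add_pi, sin_add_pi] at k2
    rw [cos_pi, sin_pi]; linarith
  obtain ⟨t, ⟨ht1, ht2⟩, ht⟩ := intermediate_value_Ioo hsπ.le hc.continuousOn ⟨hs, hπ⟩
  have hsin : 0 < sin t := sin_pos_of_pos_of_lt_pi (hs0.trans ht1) ht2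
  have hb : fwdLen p θ (θ + t) = m := by
    rw [fwdLen, add_sub_cancel_left, div_eq_iff hsin.ne']; linarith
  refine ⟨θ + t, by linarith, by linarith, ?_, hb⟩
  rw [← S.fwdLen_pos_iff (by rwa [add_sub_cancel_left]), hb]
  exact hm

end SupportData

theorem tangentPt_eq_add_smul (p : ℝ → ℝ) (θ l : ℝ) :
    tangentPt p θ l = tangentPt p θ 0 + l • ((-sin θ, cos θ) : ℝ × ℝ) := by
  ext <;> simp [tangentPt] <;> ring

theorem tangentPt_mul (p : ℝ → ℝ) (θ l c : ℝ) :
    tangentPt p θ (c * l) = tangentPt p θ 0 + c • (tangentPt p θ l - tangentPt p θ 0) := by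
  ext <;> simp [tangentPt] <;> ring

/-- The tangent ray from the contact point is monotone with respect to convex sets. -/
theorem tangentPt_mem_of_convex {C : Set (ℝ × ℝ)} (hC : Convex ℝ C) {p : ℝ → ℝ} {θ l c : ℝ}
    (h0 : tangentPt p θ 0 ∈ C) (hl : tangentPt p θ l ∈ C) (hc0 : 0 ≤ c) (hc1 : c ≤ 1) :
    tangentPt p θ (c * l) ∈ C := by
  rw [tangentPt_mul]
  exact hC.add_smul_sub_mem h0 hl ⟨hc0, hc1⟩

namespace SupportData

variable {K : Set (ℝ × ℝ)} {p : ℝ → ℝ}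

theorem exists_tangentPt_eq (S : SupportData K p) {ε : ℝ} (hε : ε = 1 ∨ ε = -1) {z : ℝ × ℝ}
    (hz : z ∉ K) : ∃ θ l, 0 < l ∧ z = tangentPt p θ (ε * l) := by
  obtain ⟨θ, l, hl, rfl⟩ := S.exists_back z hz
  rcases hε with rfl | rfl
  · obtain ⟨θ₀, h1, h2, h3, h4⟩ := S.exists_fwd_of_back (θ := θ) hl
    refine ⟨θ₀, _, h3, ?_⟩
    rw [one_mul, tangentPt_fwdLen_eq p (sin_sub_pos h2 (by linarith)).ne', h4]
  · exact ⟨θ, l, hl, by rw [neg_one_mul]⟩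

/-- The contact point of the forward or backward tangent depends continuously on the point. -/
theorem exists_contact (S : SupportData K p) {ε : ℝ} (hε : ε = 1 ∨ ε = -1) :
    ∃ α : ℝ × ℝ → ℝ × ℝ, ContinuousOn α Kᶜ ∧
      ∀ θ l, 0 < l → α (tangentPt p θ (ε * l)) = tangentPt p θ 0 := by
  have hεε : ε * ε = 1 := by rcases hε with rfl | rfl <;> norm_num
  have huniq : ∀ θ l, 0 < l → ∀ a ∈ K,
      (∀ k ∈ K, ε * ((a.1 - (tangentPt p θ (ε * l)).1) * (k.2 - (tangentPt p θ (ε * l)).2) -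
        (a.2 - (tangentPt p θ (ε * l)).2) * (k.1 - (tangentPt p θ (ε * l)).1)) ≤ 0) →
      a = tangentPt p θ 0 := by
    intro θ l hl a ha h
    have h1 := h _ (S.tangentPt_zero_mem θ)
    refine S.eq_tangentPt_of_dot_eq ha (le_antisymm (S.dot_le a ha θ) ?_)
    have h2 : 0 ≤ l * (a.1 * cos θ + a.2 * sin θ - p θ) := by
      simp only [tangentPt] at h1
      have hsc := sin_sq_add_cos_sq θ
      refine (neg_nonneg.2 h1).trans_eq ?_
      linear_combination (a.1 * cos θ + a.2 * sin θ) * l * hεε - ε * ε * l * p θ * hsc -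
        l * p θ * hεε
    linarith [nonneg_of_mul_nonneg_right h2 hl]
  have hsat : ∀ θ l, 0 < l → ∀ k ∈ K,
      ε * (((tangentPt p θ 0).1 - (tangentPt p θ (ε * l)).1) * (k.2 - (tangentPt p θ (ε * l)).2) -
        ((tangentPt p θ 0).2 - (tangentPt p θ (ε * l)).2) *
          (k.1 - (tangentPt p θ (ε * l)).1)) ≤ 0 := by
    intro θ l hl k hk
    have h1 := S.dot_le k hk θ
    have h2 : l * (k.1 * cos θ + k.2 * sin θ - p θ) ≤ 0 :=
      mul_nonpos_of_nonneg_of_nonpos hl.le (by linarith)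
    refine le_of_eq_of_le ?_ h2
    simp only [tangentPt]
    have hsc := sin_sq_add_cos_sq θ
    linear_combination (k.1 * cos θ + k.2 * sin θ) * l * hεε - ε * ε * l * p θ * hsc - l * p θ * hεε
  have hex : ∀ z, ∃ a, z ∉ K → a ∈ K ∧
      (∀ k ∈ K, ε * ((a.1 - z.1) * (k.2 - z.2) - (a.2 - z.2) * (k.1 - z.1)) ≤ 0) := by
    intro z
    by_cases hz : z ∈ K
    · exact ⟨0, fun h => (h hz).elim⟩
    obtain ⟨θ, l, hl, rfl⟩ := S.exists_tangentPt_eq hε hz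
    exact ⟨tangentPt p θ 0, fun _ => ⟨S.tangentPt_zero_mem θ, hsat θ l hl⟩⟩
  choose α hα using hex
  have hne : ∀ l : ℝ, 0 < l → ε * l ≠ 0 := by
    intro l hl; rcases hε with rfl | rfl <;> simp [hl.ne']
  have hval : ∀ θ l, 0 < l → α (tangentPt p θ (ε * l)) = tangentPt p θ 0 := fun θ l hl => by
    have := hα _ (S.tangentPt_notMem (θ := θ) (hne l hl))
    exact huniq θ l hl _ this.1 this.2
  refine ⟨α, fun z hz => ?_, hval⟩
  refine S.compact.tendsto_nhds_of_unique_mapClusterPt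
    (eventually_mem_nhdsWithin.mono fun w hw => (hα w hw).1) fun a ha hcl => ?_
  obtain ⟨θ, l, hl, rfl⟩ := S.exists_tangentPt_eq hε hz
  rw [hval θ l hl]
  refine huniq θ l hl a ha fun k hk => ?_
  obtain ⟨V, hV, hlim⟩ := mapClusterPt_iff_ultrafilter.1 hcl
  have hid : Tendsto (fun w : ℝ × ℝ => w) V (𝓝 (tangentPt p θ (ε * l))) :=
    hV.trans nhdsWithin_le_nhds
  have hmem : ∀ᶠ w in (V : Filter (ℝ × ℝ)), w ∉ K := hV self_mem_nhdsWithin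
  have a1 := (continuous_fst.tendsto _).comp hlim
  have a2 := (continuous_snd.tendsto _).comp hlim
  have w1 := (continuous_fst.tendsto _).comp hid
  have w2 := (continuous_snd.tendsto _).comp hid
  refine le_of_tendsto (((((a1.sub w1).mul (tendsto_const_nhds.sub w2)).sub
    ((a2.sub w2).mul (tendsto_const_nhds.sub w1))).const_mul ε)) (hmem.mono fun w hw => ?_)
  exact (hα w hw).2 k hk

end SupportData

/-- The points reached from a neighbourhood of infinity by moving outwards along tangent rays,
and inwards along backward tangent rays within `O`. -/
inductive Swept (p : ℝ → ℝ) (O : Set (ℝ × ℝ)) (R : ℝ) : ℝ × ℝ → Prop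
  | far {z : ℝ × ℝ} : R < ‖z‖ → Swept p O R z
  | up {ε θ l l' : ℝ} : ε = 1 ∨ ε = -1 → Swept p O R (tangentPt p θ (ε * l)) → 0 < l → l ≤ l' →
      Swept p O R (tangentPt p θ (ε * l'))
  | down {θ l l' : ℝ} : Swept p O R (tangentPt p θ (-l)) → 0 < l' → l' ≤ l →
      (∀ s ∈ Set.Icc l' l, tangentPt p θ (-s) ∈ O) → Swept p O R (tangentPt p θ (-l'))

namespace Swept

variable {K : Set (ℝ × ℝ)} {p : ℝ → ℝ} {O : Set (ℝ × ℝ)} {R : ℝ}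

theorem up_bwd {θ l l' : ℝ} (h : Swept p O R (tangentPt p θ (-l))) (hl : 0 < l) (hll' : l ≤ l') :
    Swept p O R (tangentPt p θ (-l')) := by
  rw [← neg_one_mul] at h ⊢; exact .up (Or.inr rfl) h hl hll'

theorem up_fwd {θ l l' : ℝ} (h : Swept p O R (tangentPt p θ l)) (hl : 0 < l) (hll' : l ≤ l') :
    Swept p O R (tangentPt p θ l') := by
  rw [← one_mul l] at h; rw [← one_mul l']; exact .up (Or.inl rfl) h hl hll'

theorem notMem_of_convex (S : SupportData K p) {C : Set (ℝ × ℝ)} (hC : Convex ℝ C) (hKC : K ⊆ C)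
    (hCO : Disjoint C O) (hCR : ∀ z ∈ C, ‖z‖ ≤ R) {z : ℝ × ℝ} (hz : Swept p O R z) : z ∉ C := by
  induction hz with
  | far h => exact fun h' => (hCR _ h').not_gt h
  | @up ε θ l l' hε h hl hll' ih =>
    intro h'
    have hl' : 0 < l' := hl.trans_le hll'
    have := tangentPt_mem_of_convex hC (hKC (S.tangentPt_zero_mem θ)) h' (c := l / l')
      (by positivity) ((div_le_one hl').2 hll')
    apply ih
    convert this using 2
    field_simp
  | down h hl' hll' hO ih =>
    exact fun h' => Set.disjoint_left.1 hCO h' (hO _ (Set.left_mem_Icc.2 hll'))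

theorem of_notMem_convex (S : SupportData K p) {C : Set (ℝ × ℝ)} (hC : Convex ℝ C) (hKC : K ⊆ C)
    (hCO : Cᶜ ⊆ O) {z : ℝ × ℝ} (hz : z ∉ C) : Swept p O R z := by
  obtain ⟨θ, l, hl, rfl⟩ := S.exists_back z fun h => hz (hKC h)
  have hmem : ∀ s, l ≤ s → tangentPt p θ (-s) ∉ C := by
    intro s hs h
    have hs' : 0 < s := hl.trans_le hs
    have := tangentPt_mem_of_convex hC (hKC (S.tangentPt_zero_mem θ)) h (c := l / s)
      (by positivity) ((div_le_one hs').2 hs)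
    apply hz
    convert this using 2
    field_simp
  have hlim : Tendsto (fun s : ℝ => ‖tangentPt p θ (-s)‖) atTop atTop := by
    have hv : 0 < ‖((-sin θ, cos θ) : ℝ × ℝ)‖ := by
      rw [norm_pos_iff]
      intro h
      have h1 := congrArg Prod.fst h
      have h2 := congrArg Prod.snd h
      simp only [Prod.fst_zero, Prod.snd_zero, neg_eq_zero] at h1 h2
      have := sin_sq_add_cos_sq θ
      rw [h1, h2] at this; norm_num at this
    refine tendsto_atTop_mono (f := fun s => s * ‖((-sin θ, cos θ) : ℝ × ℝ)‖ - ‖tangentPt p θ 0‖)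
      (fun s => ?_) (tendsto_atTop_add_const_right _ _ (tendsto_id.atTop_mul_const hv))
    rw [tangentPt_eq_add_smul p θ (-s)]
    have h1 : ‖(-s) • ((-sin θ, cos θ) : ℝ × ℝ)‖ ≤
        ‖tangentPt p θ 0 + (-s) • ((-sin θ, cos θ) : ℝ × ℝ)‖ + ‖tangentPt p θ 0‖ := by
      have := norm_sub_le (tangentPt p θ 0 + (-s) • ((-sin θ, cos θ) : ℝ × ℝ)) (tangentPt p θ 0)
      rwa [add_sub_cancel_left] at this
    rw [norm_smul, norm_neg, norm_eq_abs] at h1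
    nlinarith [le_abs_self s, mul_le_mul_of_nonneg_right (le_abs_self s) hv.le]
  obtain ⟨s, hs1, hs2⟩ := ((hlim.eventually_gt_atTop R).and (eventually_ge_atTop l)).exists
  exact .down (.far hs1) hl hs2 fun t ht => hCO (hmem t ht.1)

theorem isOpen (S : SupportData K p) (hO : IsOpen O) (hKO : Disjoint K O)
    (hKR : ∀ z ∈ K, ‖z‖ ≤ R) : IsOpen {z | Swept p O R z} := by
  rw [isOpen_iff_eventually]
  intro z (hz : Swept p O R z)
  have hKcl : IsOpen Kᶜ := S.compact.isClosed.isOpen_compl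
  have hzK : ∀ z, Swept p O R z → z ∉ K := fun z hz =>
    hz.notMem_of_convex S S.convex subset_rfl hKO hKR
  induction hz with
  | far h =>
    filter_upwards [continuous_norm.continuousAt.eventually_const_lt h] with w hw
    exact .far hw
  | @up ε θ l l' hε h hl hll' ih =>
    have hl' : 0 < l' := hl.trans_le hll'
    have hmem := hzK _ (.up hε h hl hll')
    obtain ⟨α, hαc, hα⟩ := S.exists_contact hε
    have hαz : ContinuousAt α (tangentPt p θ (ε * l')) := hαc.continuousAt (hKcl.mem_nhds hmem)
    have hg : ContinuousAt (fun w => α w + (l / l') • (w - α w)) (tangentPt p θ (ε * l')) := by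
      fun_prop
    have hgz : α (tangentPt p θ (ε * l')) + (l / l') • (tangentPt p θ (ε * l') -
        α (tangentPt p θ (ε * l'))) = tangentPt p θ (ε * l) := by
      rw [hα θ l' hl', ← tangentPt_mul]; congr 1; field_simp
    have := hg.tendsto
    rw [hgz] at this
    filter_upwards [this.eventually ih, hKcl.mem_nhds hmem] with w hw hwK
    obtain ⟨φ, s, hs, rfl⟩ := S.exists_tangentPt_eq hε hwK
    rw [hα φ s hs, ← tangentPt_mul, mul_left_comm] at hw
    refine .up hε hw (by positivity) ?_
    exact mul_le_of_le_one_left hs.le ((div_le_one hl').2 hll')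
  | @down θ l l' h hl' hll' hs ih =>
    have hl : 0 < l := hl'.trans_le hll'
    have hmem := hzK _ (.down h hl' hll' hs)
    obtain ⟨α, hαc, hα'⟩ := S.exists_contact (Or.inr rfl)
    have hα : ∀ θ l, 0 < l → α (tangentPt p θ (-l)) = tangentPt p θ 0 := by
      intro θ l hl; rw [← neg_one_mul]; exact hα' θ l hl
    have hαz : ContinuousAt α (tangentPt p θ (-l')) := hαc.continuousAt (hKcl.mem_nhds hmem)
    have hg : ContinuousAt (fun w => α w + (l / l') • (w - α w)) (tangentPt p θ (-l')) := by
      fun_prop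
    have hgz : ∀ c : ℝ, α (tangentPt p θ (-l')) + c • (tangentPt p θ (-l') -
        α (tangentPt p θ (-l'))) = tangentPt p θ (-(c * l')) := by
      intro c; rw [hα θ l' hl', ← tangentPt_mul]; congr 1; ring
    have := hg.tendsto
    rw [hgz, div_mul_cancel₀ _ hl'.ne'] at this
    have hcpt : ∀ᶠ w in 𝓝 (tangentPt p θ (-l')), ∀ c ∈ Set.Icc 1 (l / l'),
        α w + c • (w - α w) ∈ O := by
      refine isCompact_Icc.eventually_forall_of_forall_eventually fun c hc => ?_
      have hG : ContinuousAt (fun q : (ℝ × ℝ) × ℝ => α q.1 + q.2 • (q.1 - α q.1))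
          (tangentPt p θ (-l'), c) := by
        have : ContinuousAt (fun q : (ℝ × ℝ) × ℝ => α q.1) (tangentPt p θ (-l'), c) :=
          ContinuousAt.comp (f := Prod.fst) hαz continuousAt_fst
        fun_prop
      have hmemO : α (tangentPt p θ (-l')) + c • (tangentPt p θ (-l') -
          α (tangentPt p θ (-l'))) ∈ O := by
        rw [hgz]
        refine hs _ ⟨le_mul_of_one_le_left hl'.le hc.1, ?_⟩
        rw [← le_div_iff₀ hl']; exact hc.2
      exact hG.eventually (hO.mem_nhds hmemO)
    filter_upwards [this.eventually ih, hKcl.mem_nhds hmem, hcpt] with w hw hwK hwO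
    obtain ⟨φ, s, hs, rfl⟩ := S.exists_back w hwK
    have hrw : ∀ c : ℝ, α (tangentPt p φ (-s)) + c • (tangentPt p φ (-s) -
        α (tangentPt p φ (-s))) = tangentPt p φ (-(c * s)) := by
      intro c; rw [hα φ s hs, ← tangentPt_mul]; congr 1; ring
    rw [hrw] at hw
    have h1 : 1 ≤ l / l' := (one_le_div hl').2 hll'
    refine .down hw hs (le_mul_of_one_le_left hs.le h1) fun t ht => ?_
    have := hwO (t / s) ⟨(one_le_div hs).2 ht.1, (div_le_iff₀ hs).2 ht.2⟩
    rwa [hrw, div_mul_cancel₀ _ hs.ne'] at this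

end Swept

namespace SupportData

variable {K : Set (ℝ × ℝ)} {p : ℝ → ℝ}

theorem bwd_inj (S : SupportData K p) {θ θ' l l' : ℝ} (hl : 0 < l) (hl' : 0 < l')
    (e : tangentPt p θ (-l) = tangentPt p θ' (-l')) :
    (∀ s, tangentPt p θ' s = tangentPt p θ s) ∧ l = l' := by
  rw [← neg_one_mul, ← neg_one_mul l'] at e
  obtain ⟨⟨n, rfl⟩, h⟩ := S.tangentPt_inj_mod (Or.inr rfl) hl hl' e
  exact ⟨fun s => S.tangentPt_add_int _ _ _, h⟩

theorem fwd_inj (S : SupportData K p) {θ θ' l l' : ℝ} (hl : 0 < l) (hl' : 0 < l')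
    (e : tangentPt p θ l = tangentPt p θ' l') :
    (∀ s, tangentPt p θ' s = tangentPt p θ s) ∧ l = l' := by
  rw [← one_mul l, ← one_mul l'] at e
  obtain ⟨⟨n, rfl⟩, h⟩ := S.tangentPt_inj_mod (Or.inl rfl) hl hl' e
  exact ⟨fun s => S.tangentPt_add_int _ _ _, h⟩

end SupportData

namespace Swept

variable {K : Set (ℝ × ℝ)} {p : ℝ → ℝ} {O : Set (ℝ × ℝ)} {R : ℝ}

/-- Descending along a backward tangent ray inside `O`, the preimages under the dual billiard map
stay swept. -/
theorem bwd_of_path (S : SupportData K p) (hO : IsOpen O)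
    (hOinv : ∀ θ m, 0 < m → tangentPt p θ m ∈ O → tangentPt p θ (-m) ∈ O)
    (hopen : IsOpen {z | Swept p O R z}) {θ u v : ℝ} (huv : u ≤ v) (hu : θ - π < u) (hv : v < θ)
    (hpos : 0 < backLen p v θ)
    (hpath : ∀ s ∈ Set.Icc (backLen p v θ) (backLen p u θ), tangentPt p θ (-s) ∈ O)
    (hstart : Swept p O R (tangentPt p u (-fwdLen p u θ))) :
    Swept p O R (tangentPt p v (-fwdLen p v θ)) := by
  have hp := S.differentiable.continuous
  have hp' := S.continuous_deriv
  have hsin : ∀ t ∈ Set.Icc u v, 0 < sin (θ - t) := fun t ht =>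
    sin_sub_pos (ht.2.trans_lt hv) (by linarith [ht.1])
  have hb : ∀ t ∈ Set.Icc u v, backLen p t θ ∈ Set.Icc (backLen p v θ) (backLen p u θ) :=
    fun t ht => ⟨S.backLen_anti (by linarith [ht.1]) ht.2 hv,
      S.backLen_anti hu ht.1 (ht.2.trans_lt hv)⟩
  have hf : ∀ t ∈ Set.Icc u v, 0 < fwdLen p t θ := fun t ht =>
    (S.fwdLen_pos_iff (hsin t ht)).2 (hpos.trans_le (hb t ht).1)
  have hyO : ∀ t ∈ Set.Icc u v, tangentPt p t (-fwdLen p t θ) ∈ O := fun t ht => by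
    apply hOinv t _ (hf t ht)
    rw [tangentPt_fwdLen_eq p (hsin t ht).ne']
    exact hpath _ (hb t ht)
  have hfc : ∀ t ∈ Set.Icc u v, ContinuousAt (fun t => fwdLen p t θ) t := fun t ht =>
    ContinuousAt.comp (f := fun t => (t, θ)) (g := fun q : ℝ × ℝ => fwdLen p q.1 q.2)
      (continuousAt_fwdLen hp hp' (hsin t ht).ne') (by fun_prop)
  have htc := continuous_tangentPt hp hp'
  have hyc : ∀ t ∈ Set.Icc u v, ContinuousAt (fun t => tangentPt p t (-fwdLen p t θ)) t :=
    fun t ht => htc.continuousAt.comp (f := fun t => (t, -fwdLen p t θ))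
      (continuousAt_id.prodMk (hfc t ht).neg)
  by_contra hcon
  have hTc : IsCompact (Set.Icc u v ∩ (fun t => tangentPt p t (-fwdLen p t θ)) ⁻¹'
      {z | Swept p O R z}ᶜ) :=
    isCompact_Icc.of_isClosed_subset (ContinuousOn.preimage_isClosed_of_isClosed
      (fun t ht => (hyc t ht).continuousWithinAt) isClosed_Icc hopen.isClosed_compl)
      Set.inter_subset_left
  obtain ⟨t₀, ⟨ht₀, hnot⟩, hleast⟩ := hTc.exists_isLeast ⟨v, Set.right_mem_Icc.2 huv, hcon⟩
  have hut : u < t₀ := ht₀.1.lt_of_ne fun h => hnot (h ▸ hstart)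
  obtain ⟨w, hw1, hw2, hw3, hw4⟩ := S.exists_fwd_of_back (θ := t₀) (hf t₀ ht₀)
  have hbc : ContinuousAt (fun t => backLen p w t) t₀ :=
    ContinuousAt.comp (f := fun t => (w, t)) (g := fun q : ℝ × ℝ => backLen p q.1 q.2)
      (continuousAt_backLen hp hp' (sin_sub_pos hw2 (by linarith)).ne') (by fun_prop)
  have hfw : ContinuousAt (fun t => fwdLen p w t) t₀ :=
    ContinuousAt.comp (f := fun t => (w, t)) (g := fun q : ℝ × ℝ => fwdLen p q.1 q.2)
      (continuousAt_fwdLen hp hp' (sin_sub_pos hw2 (by linarith)).ne') (by fun_prop)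
  have hOn : ∀ᶠ q : ℝ × ℝ in 𝓝 (t₀, fwdLen p t₀ θ), tangentPt p q.1 (-q.2) ∈ O := by
    have : Continuous fun q : ℝ × ℝ => tangentPt p q.1 (-q.2) :=
      htc.comp (continuous_fst.prodMk continuous_snd.neg)
    exact this.continuousAt.eventually (hO.mem_nhds (hyO t₀ ht₀))
  obtain ⟨δ, hδ, hball⟩ := Metric.eventually_nhds_iff.1 hOn
  have e1 : ∀ᶠ t in 𝓝 t₀, |fwdLen p t θ - fwdLen p t₀ θ| < δ :=
    (hfc t₀ ht₀).eventually (Metric.ball_mem_nhds _ hδ)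
  have e2 : ∀ᶠ t in 𝓝 t₀, |backLen p w t - fwdLen p t₀ θ| < δ := by
    rw [← hw4]
    exact hbc.eventually (Metric.ball_mem_nhds _ hδ)
  have e3 : ∀ᶠ t in 𝓝 t₀, |t - t₀| < δ := Metric.ball_mem_nhds _ hδ
  have e4 : ∀ᶠ t in 𝓝 t₀, 0 < fwdLen p w t := hfw.eventually_const_lt hw3
  have e5 : ∀ᶠ t in 𝓝 t₀, w < t := eventually_gt_nhds hw2
  obtain ⟨t, ⟨⟨⟨⟨h1, h2⟩, h3⟩, h4⟩, h5⟩, h6, h7⟩ :=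
    ((((((e1.and e2).and e3).and e4).and e5).filter_mono nhdsWithin_le_nhds).and
      (Ioo_mem_nhdsLT hut)).exists
  have ht : t ∈ Set.Icc u v := ⟨h6.le, h7.le.trans ht₀.2⟩
  have hyt : Swept p O R (tangentPt p t (-fwdLen p t θ)) := by
    by_contra hn
    exact h7.not_ge (hleast ⟨ht, hn⟩)
  have hsw : 0 < sin (t - w) := sin_sub_pos h5 (by linarith)
  have hbpos := (S.fwdLen_pos_iff hsw).1 h4
  have hx : Swept p O R (tangentPt p t (-backLen p w t)) := by
    rcases le_total (fwdLen p t θ) (backLen p w t) with h | h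
    · exact hyt.up_bwd (hf t ht) h
    · refine hyt.down hbpos h fun s hs => ?_
      refine @hball (t, s) ?_
      rw [Prod.dist_eq, max_lt_iff]
      refine ⟨h3, ?_⟩
      rw [abs_lt] at h1 h2
      rw [Real.dist_eq, abs_lt]
      constructor <;> linarith [hs.1, hs.2, h1.2, h2.1]
  rw [← tangentPt_fwdLen_eq p hsw.ne'] at hx
  have := hx.up_fwd h4 (S.fwdLen_mono h5 h7.le (by linarith))
  rw [tangentPt_fwdLen_eq p (sin_sub_pos hw2 (by linarith)).ne', hw4] at this
  exact hnot this

/-- The swept set is invariant under the inverse of the dual billiard map. -/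
theorem bwd_of_fwd (S : SupportData K p) (hO : IsOpen O) (hKO : Disjoint K O)
    (hOinv : ∀ θ m, 0 < m → tangentPt p θ m ∈ O → tangentPt p θ (-m) ∈ O)
    {M R₀ : ℝ} (hKM : ∀ z ∈ K, ‖z‖ ≤ M) (hMR : M ≤ R₀) (hR₀ : ∀ z, R₀ < ‖z‖ → z ∈ O)
    (hR : R₀ + 2 * M ≤ R) {θ m : ℝ} (hm : 0 < m) (h : Swept p O R (tangentPt p θ m)) :
    Swept p O R (tangentPt p θ (-m)) := by
  have hM : 0 ≤ M := by
    obtain ⟨k, hk⟩ : K.Nonempty := ⟨_, S.tangentPt_zero_mem 0⟩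
    exact (norm_nonneg k).trans (hKM k hk)
  have hopen : IsOpen {z | Swept p O R z} :=
    Swept.isOpen S hO hKO fun z hz => (hKM z hz).trans (by linarith)
  suffices H : ∀ z, Swept p O R z → ∀ θ₁ l, 0 < l → z = tangentPt p θ₁ (-l) → ∀ l', l ≤ l' →
      ∀ θ₀ m, 0 < m → tangentPt p θ₁ (-l') = tangentPt p θ₀ m → Swept p O R (tangentPt p θ₀ (-m)) by
    obtain ⟨θ₁, l, hl, e⟩ := S.exists_back _ (S.tangentPt_notMem (θ := θ) hm.ne')
    exact H _ h θ₁ l hl e l le_rfl θ m hm e.symm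
  intro z hz
  induction hz with
  | @far z h =>
    rintro θ₁ l hl rfl l' hll' θ₀ m hm e
    have hKR : K ⊆ Metric.closedBall 0 R := fun k hk => by
      rw [mem_closedBall_zero_iff]; linarith [hKM k hk]
    have hl' : 0 < l' := hl.trans_le hll'
    have h1 : R < ‖tangentPt p θ₀ m‖ := by
      rw [← e]
      by_contra hcon
      have := tangentPt_mem_of_convex (convex_closedBall (0 : ℝ × ℝ) R)
        (hKR (S.tangentPt_zero_mem θ₁)) (mem_closedBall_zero_iff.2 (not_lt.1 hcon)) (c := l / l')
        (by positivity) ((div_le_one hl').2 hll')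
      rw [mul_neg, div_mul_cancel₀ _ hl'.ne', mem_closedBall_zero_iff] at this
      linarith
    have h2 : tangentPt p θ₀ m = tangentPt p θ₀ 0 + tangentPt p θ₀ 0 - tangentPt p θ₀ (-m) := by
      rw [tangentPt_eq_add_smul p θ₀ m, tangentPt_eq_add_smul p θ₀ (-m), neg_smul]; abel
    have h3 := norm_sub_le (tangentPt p θ₀ 0 + tangentPt p θ₀ 0) (tangentPt p θ₀ (-m))
    have h4 := norm_add_le (tangentPt p θ₀ 0) (tangentPt p θ₀ 0)
    have h5 := hKM _ (S.tangentPt_zero_mem θ₀)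
    rw [← h2] at h3
    refine of_notMem_convex S (convex_closedBall (0 : ℝ × ℝ) R₀) (fun k hk => ?_) (fun w hw => ?_)
      (z := tangentPt p θ₀ (-m)) ?_
    · rw [mem_closedBall_zero_iff]; linarith [hKM k hk]
    · exact hR₀ w (by simpa using hw)
    · rw [mem_closedBall_zero_iff, not_le]; linarith
  | @up ε θ l l₂ hε h hl hll₂ ih =>
    rcases hε with rfl | rfl
    · simp only [one_mul] at *
      intro θ₂' l₂' hl₂' e l₃ hl₃ θ₃' m₃' hm₃' e₃
      rcases hll₂.eq_or_lt with rfl | hlt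
      · exact ih θ₂' l₂' hl₂' e l₃ hl₃ θ₃' m₃' hm₃' e₃
      obtain ⟨θ₁, h1a, h1b, h1c, h1d⟩ := S.exists_back_of_fwd (θ := θ) hl
      obtain ⟨θ₂, h2a, h2b, h2c, h2d⟩ := S.exists_back_of_fwd (θ := θ) (hl.trans hlt)
      have h12 : θ₁ < θ₂ := by
        by_contra! hcon
        have := S.fwdLen_mono h2a hcon h1b
        linarith
      have e2 := tangentPt_fwdLen_eq p (sin_sub_pos h2a h2b).ne'
      rw [h2d, e] at e2
      obtain ⟨hθ₂, hl₂⟩ := S.bwd_inj hl₂' h2c e2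
      obtain ⟨θ₃, h3a, h3b, h3c, h3d⟩ : ∃ θ₃, θ₂ - π < θ₃ ∧ θ₃ ≤ θ ∧ 0 < fwdLen p θ₃ θ₂ ∧
          backLen p θ₃ θ₂ = l₃ := by
        obtain ⟨θ₃, a, b, c, d⟩ := S.exists_fwd_of_back (θ := θ₂) (hl₂'.trans_le hl₃)
        rcases le_or_gt θ₃ θ with hle | hgt
        · exact ⟨θ₃, a, hle, c, d⟩
        · have := S.backLen_anti (by linarith) hgt.le b
          exact ⟨θ, by linarith, le_rfl, by rw [h2d]; exact hl.trans hlt, by linarith⟩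
      have e3 := tangentPt_fwdLen_eq p (sin_sub_pos (h3b.trans_lt h2a) (by linarith)).ne'
      rw [h3d, hθ₂, e₃] at e3
      obtain ⟨hθ₃, hm₃⟩ := S.fwd_inj h3c hm₃' e3
      rw [hθ₃, ← hm₃]
      have s31 : 0 < sin (θ₁ - θ₃) := sin_sub_pos (h3b.trans_lt h1a) (by linarith)
      have hb := S.backLen_anti (by linarith) h3b h1a
      have hf31 : 0 < fwdLen p θ₃ θ₁ := (S.fwdLen_pos_iff s31).2 (h1c.trans_le hb)
      have e1 := tangentPt_fwdLen_eq p (sin_sub_pos h1a h1b).ne'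
      rw [h1d] at e1
      exact (ih θ₁ _ h1c e1 _ hb θ₃ _ hf31 (tangentPt_fwdLen_eq p s31.ne').symm).up_bwd hf31
        (S.fwdLen_mono (h3b.trans_lt h1a) h12.le (by linarith))
    · simp only [neg_one_mul] at *
      intro θ₁ l₁ hl₁ e l₃ hl₃ θ₀ m hm e₃
      obtain ⟨hθ, rfl⟩ := S.bwd_inj (hl.trans_le hll₂) hl₁ e
      rw [hθ] at e₃
      exact ih θ l hl rfl l₃ (hll₂.trans hl₃) θ₀ m hm e₃
  | @down θ l l' h hl' hll' hs ih =>
    intro θ₁ l₁ hl₁ e l₃ hl₃ θ₀ m hm e₃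
    obtain ⟨hθ, rfl⟩ := S.bwd_inj hl' hl₁ e
    rw [hθ] at e₃
    rcases le_or_gt l l₃ with hc | hc
    · exact ih θ l (hl'.trans_le hll') rfl l₃ hc θ₀ m hm e₃
    obtain ⟨u, hu1, hu2, hu3, hu4⟩ := S.exists_fwd_of_back (θ := θ) (hl'.trans_le hll')
    obtain ⟨v, hv1, hv2, hv3, hv4⟩ := S.exists_fwd_of_back (θ := θ) (hl'.trans_le hl₃)
    have huv : u ≤ v := by
      by_contra! hcon
      have := S.backLen_anti hv1 hcon.le hu2
      linarith
    have ev := tangentPt_fwdLen_eq p (sin_sub_pos hv2 (by linarith)).ne'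
    rw [hv4, e₃] at ev
    obtain ⟨hθ₀, rfl⟩ := S.fwd_inj hv3 hm ev
    rw [hθ₀]
    have eu := tangentPt_fwdLen_eq p (sin_sub_pos hu2 (by linarith)).ne'
    rw [hu4] at eu
    refine bwd_of_path S hO hOinv hopen huv hu1 hv2 (by rw [hv4]; linarith) (fun s hs' => ?_)
      (ih θ l (hl'.trans_le hll') rfl l le_rfl u _ hu3 eu.symm)
    rw [hv4, hu4] at hs'
    exact hs s ⟨hl₃.trans hs'.1, hs'.2⟩

end Swept

section logarithm

variable {X : Type*} [TopologicalSpace X]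

theorem exists_log_sub_of_norm_lt (φ : C(X, ℂ)) {w w' : ℂ} (h : ∀ x, ‖w - w'‖ < ‖φ x - w‖)
    (hw : ∃ f : C(X, ℂ), ∀ x, Complex.exp (f x) = φ x - w) :
    ∃ f : C(X, ℂ), ∀ x, Complex.exp (f x) = φ x - w' := by
  obtain ⟨f, hf⟩ := hw
  have hne : ∀ x, φ x - w ≠ 0 := fun x => norm_pos_iff.1 ((norm_nonneg _).trans_lt (h x))
  have hmem : ∀ x, 1 + (w - w') / (φ x - w) ∈ Complex.slitPlane := fun x => by
    refine Complex.mem_slitPlane_of_norm_lt_one ?_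
    rw [norm_div, div_lt_one (norm_pos_iff.2 (hne x))]
    exact h x
  have hc : Continuous fun x => Complex.log (1 + (w - w') / (φ x - w)) :=
    Continuous.clog (continuous_const.add (continuous_const.div (by fun_prop) hne)) hmem
  refine ⟨f + ⟨_, hc⟩, fun x => ?_⟩
  simp only [ContinuousMap.add_apply, ContinuousMap.coe_mk]
  rw [Complex.exp_add, hf, Complex.exp_log (Complex.slitPlane_ne_zero (hmem x))]
  have := hne x
  field_simp
  ring

theorem exists_log_sub_of_norm_lt_norm (φ : C(X, ℂ)) {w : ℂ} (h : ∀ x, ‖φ x‖ < ‖w‖) :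
    ∃ f : C(X, ℂ), ∀ x, Complex.exp (f x) = φ x - w := by
  rcases isEmpty_or_nonempty X with hX | ⟨⟨x₀⟩⟩
  · exact ⟨0, fun x => hX.elim x⟩
  have hw : w ≠ 0 := norm_pos_iff.1 ((norm_nonneg _).trans_lt (h x₀))
  have hmem : ∀ x, 1 + (-(φ x / w)) ∈ Complex.slitPlane := fun x => by
    refine Complex.mem_slitPlane_of_norm_lt_one ?_
    rw [norm_neg, norm_div, div_lt_one (norm_pos_iff.2 hw)]
    exact h x
  have hc : Continuous fun x => Complex.log (1 + (-(φ x / w))) :=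
    Continuous.clog (by fun_prop) hmem
  refine ⟨ContinuousMap.const X (Complex.log (-w)) + ⟨_, hc⟩, fun x => ?_⟩
  simp only [ContinuousMap.add_apply, ContinuousMap.coe_mk, ContinuousMap.const_apply]
  rw [Complex.exp_add, Complex.exp_log (neg_ne_zero.2 hw),
    Complex.exp_log (Complex.slitPlane_ne_zero (hmem x))]
  field_simp
  ring

/-- A loop has winding number zero around every point that can be joined to infinity without
crossing the loop. -/
theorem exists_log_sub_of_isPreconnected [CompactSpace X] (φ : C(X, ℂ)) {s : Set ℂ}
    (hs : IsPreconnected s) (hdisj : Disjoint s (Set.range φ)) {w₀ w : ℂ} (hw₀ : w₀ ∈ s)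
    (hfar : ∀ x, ‖φ x‖ < ‖w₀‖) (hw : w ∈ s) :
    ∃ f : C(X, ℂ), ∀ x, Complex.exp (f x) = φ x - w := by
  refine (hs.induction₂ (fun w w' => (∃ f : C(X, ℂ), ∀ x, Complex.exp (f x) = φ x - w) ↔
    (∃ f : C(X, ℂ), ∀ x, Complex.exp (f x) = φ x - w')) (fun w hw => ?_)
    (fun a b c _ _ _ => Iff.trans) (fun a b _ _ => Iff.symm) hw₀ hw).1
    (exists_log_sub_of_norm_lt_norm φ hfar)
  have hcl : IsClosed (Set.range φ) := (isCompact_range φ.continuous).isClosed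
  obtain ⟨d, hd, hball⟩ := Metric.isOpen_iff.1 hcl.isOpen_compl w
    (Set.disjoint_left.1 hdisj hw)
  have hdist : ∀ x, d ≤ ‖φ x - w‖ := fun x => by
    by_contra! hlt
    exact hball (by rwa [Metric.mem_ball, dist_eq_norm]) ⟨x, rfl⟩
  refine mem_nhdsWithin_of_mem_nhds ?_
  filter_upwards [Metric.ball_mem_nhds w (by positivity : 0 < d / 3)] with w' hw'
  rw [Metric.mem_ball, dist_eq_norm] at hw'
  constructor <;> refine exists_log_sub_of_norm_lt φ fun x => ?_
  · rw [norm_sub_rev]; linarith [hdist x]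
  · have : ‖φ x - w‖ ≤ ‖φ x - w'‖ + ‖w' - w‖ := by
      simpa using norm_add_le (φ x - w') (w' - w)
    linarith [hdist x]

/-- A map into the complement of a bounded convex set that has a logarithm relative to a point of
the set is nullhomotopic. -/
theorem nullhomotopic_of_exists_log [CompactSpace X] {K : Set (ℝ × ℝ)} (hK : Convex ℝ K)
    (hb : Bornology.IsBounded K) {k₀ : ℝ × ℝ} (hk₀ : k₀ ∈ K) (ℓ : C(X, (Kᶜ : Set (ℝ × ℝ))))
    (f : C(X, ℂ)) (hf : ∀ x, Complex.exp (f x) = Complex.equivRealProdCLM.symm ((ℓ x).1 - k₀)) :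
    ContinuousMap.Nullhomotopic ℓ := by
  obtain ⟨B, hB⟩ : ∃ B, ∀ z ∈ K, ‖Complex.equivRealProdCLM.symm (z - k₀)‖ ≤ B := by
    obtain ⟨M, hM⟩ := hb.exists_norm_le
    refine ⟨‖(Complex.equivRealProdCLM.symm : ℝ × ℝ →L[ℝ] ℂ)‖ * (M + ‖k₀‖), fun z hz => ?_⟩
    refine ((Complex.equivRealProdCLM.symm : ℝ × ℝ →L[ℝ] ℂ).le_opNorm (z - k₀)).trans ?_
    gcongr
    exact (norm_sub_le _ _).trans (by gcongr; exact hM z hz)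
  obtain ⟨F, hF⟩ := (isCompact_range f.continuous).isBounded.exists_norm_le
  have hF' : ∀ x, ‖f x‖ ≤ F := fun x => hF _ ⟨x, rfl⟩
  have hfar : ∀ z : ℂ, B < ‖z‖ → k₀ + Complex.equivRealProdCLM z ∈ Kᶜ := fun z hz h => by
    have := hB _ h
    simp only [add_sub_cancel_left, ContinuousLinearEquiv.symm_apply_apply] at this
    linarith
  set M : ℝ := |F| + |B| with hM
  have hM0 : 0 ≤ M := by positivity
  have hmem₁ : ∀ q : unitInterval × X,
      k₀ + Complex.equivRealProdCLM (Complex.exp (f q.2 + (q.1 : ℝ) * M)) ∈ Kᶜ := by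
    rintro ⟨t, x⟩ h
    have e : Complex.exp (f x + (t : ℝ) * M) = rexp (t * M) • Complex.exp (f x) := by
      rw [Complex.exp_add, Complex.real_smul, mul_comm]; push_cast; rfl
    simp only at h
    rw [e, map_smul, hf, ContinuousLinearEquiv.apply_symm_apply] at h
    have h1 : 1 ≤ rexp (t * M) := one_le_exp (mul_nonneg t.2.1 hM0)
    have := hK.add_smul_sub_mem hk₀ h (t := (rexp (t * M))⁻¹)
      ⟨by positivity, inv_le_one_of_one_le₀ h1⟩
    rw [add_sub_cancel_left, inv_smul_smul₀ (exp_ne_zero _), add_sub_cancel] at this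
    exact (ℓ x).2 this
  have hmem₂ : ∀ q : unitInterval × X,
      k₀ + Complex.equivRealProdCLM (Complex.exp (((1 - q.1 : ℝ) : ℂ) * f q.2 + M)) ∈ Kᶜ := by
    rintro ⟨t, x⟩
    apply hfar
    rw [Complex.norm_exp, Complex.add_re, Complex.re_ofReal_mul, Complex.ofReal_re]
    have h1 : -|F| ≤ (1 - (t : ℝ)) * (f x).re := by
      have h2 : |(f x).re| ≤ |F| := (Complex.abs_re_le_norm _).trans ((hF' x).trans (le_abs_self F))
      have h3 : |(1 - (t : ℝ)) * (f x).re| ≤ |F| := by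
        rw [abs_mul, abs_of_nonneg (by linarith [t.2.2])]
        exact (mul_le_of_le_one_left (abs_nonneg _) (by linarith [t.2.1])).trans h2
      exact (abs_le.1 h3).1
    calc B < |B| + 1 := by linarith [le_abs_self B]
      _ ≤ rexp |B| := add_one_le_exp _
      _ ≤ _ := exp_le_exp.2 (by linarith)
  have hc₁ : Continuous fun q : unitInterval × X =>
      (⟨_, hmem₁ q⟩ : (Kᶜ : Set (ℝ × ℝ))) := by
    refine Continuous.subtype_mk ?_ _
    fun_prop
  have hc₂ : Continuous fun q : unitInterval × X =>
      (⟨_, hmem₂ q⟩ : (Kᶜ : Set (ℝ × ℝ))) := by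
    refine Continuous.subtype_mk ?_ _
    fun_prop
  refine ⟨⟨k₀ + Complex.equivRealProdCLM (Complex.exp M), ?_⟩, ?_⟩
  · rcases isEmpty_or_nonempty X with hX | ⟨⟨x⟩⟩
    · apply hfar
      rw [Complex.norm_exp, Complex.ofReal_re]
      have := add_one_le_exp M
      linarith [le_abs_self B, abs_nonneg F]
    · simpa using hmem₂ (1, x)
  · refine ContinuousMap.Homotopic.trans (g := ⟨fun x => ⟨_, hmem₂ (0, x)⟩,
      hc₂.comp (by fun_prop : Continuous fun x : X => ((0 : unitInterval), x))⟩)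
      ⟨⟨⟨_, hc₁⟩, fun x => ?_, fun x => ?_⟩⟩ ⟨⟨⟨_, hc₂⟩, fun x => ?_, fun x => ?_⟩⟩
    · apply Subtype.ext; ext <;> simp [hf]
    · apply Subtype.ext; simp
    · rfl
    · apply Subtype.ext; simp

end logarithm

theorem isPreconnected_compl_of_convex {C : Set (ℝ × ℝ)} (hC : Convex ℝ C)
    (hb : Bornology.IsBounded C) : IsPreconnected Cᶜ := by
  rcases C.eq_empty_or_nonempty with rfl | ⟨k₀, hk₀⟩
  · rw [Set.compl_empty]; exact isPreconnected_univ
  obtain ⟨r, hr0, hr⟩ := hb.subset_ball_lt 0 k₀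
  have hsph : ∀ z ∈ Metric.sphere k₀ r, z ∉ C := fun z hz h =>
    (Metric.mem_ball.1 (hr h)).ne hz
  have hrank : 1 < Module.rank ℝ (ℝ × ℝ) := by
    rw [rank_prod', Module.rank_self]; norm_num
  obtain ⟨x₀, hx₀⟩ : (Metric.sphere k₀ r).Nonempty := (NormedSpace.sphere_nonempty).2 hr0.le
  refine isPreconnected_of_forall x₀ fun y hy => ?_
  have hy0 : 0 < ‖y - k₀‖ := norm_pos_iff.2 (sub_ne_zero.2 fun h => hy (h ▸ hk₀))
  set c := r / ‖y - k₀‖ with hc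
  have hc0 : 0 < c := by positivity
  set y' := k₀ + c • (y - k₀) with hy'
  have hy's : y' ∈ Metric.sphere k₀ r := by
    rw [mem_sphere_iff_norm, hy', add_sub_cancel_left, norm_smul, norm_of_nonneg hc0.le, hc,
      div_mul_cancel₀ _ hy0.ne']
  refine ⟨Metric.sphere k₀ r ∪ segment ℝ y' y, ?_, Or.inl hx₀, Or.inr (right_mem_segment _ _ _),
    IsPreconnected.union y' hy's (left_mem_segment _ _ _) (isPreconnected_sphere hrank _ _)
      (convex_segment _ _).isPreconnected⟩
  rintro z (hz | ⟨a, b, ha, hb, hab, rfl⟩)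
  · exact hsph z hz
  intro hz
  have e : a • y' + b • y = k₀ + (a * c + b) • (y - k₀) := by
    rw [hy', show a = 1 - b by linarith]; module
  rw [e] at hz
  have hcone : ∀ t, 0 ≤ t → t ≤ a * c + b → k₀ + t • (y - k₀) ∈ C := by
    intro t ht ht'
    rcases ht.eq_or_lt with rfl | ht
    · simpa using hk₀
    have := hC.add_smul_sub_mem hk₀ hz (t := t / (a * c + b))
      ⟨by positivity, (div_le_one (ht.trans_le ht')).2 ht'⟩
    rwa [add_sub_cancel_left, smul_smul, div_mul_cancel₀ _ (ht.trans_le ht').ne'] at this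
  rcases le_total c 1 with h | h
  · exact hsph _ hy's (hcone c hc0.le (by nlinarith))
  · apply hy
    simpa using hcone 1 zero_le_one (by nlinarith)

/-- The unbounded complementary component of an invariant circle. -/
theorem DBInvCircle.exists_outer {K : Set (ℝ × ℝ)} {p : ℝ → ℝ} (S : SupportData K p)
    {Φ : ℝ × ℝ → ℝ × ℝ} (hΦ : ∀ θ l, 0 < l → Φ (tangentPt p θ (-l)) = tangentPt p θ l)
    {Ω : Set (ℝ × ℝ)} (h : DBInvCircle K Φ Ω) {ε : ℝ}
    (hΩ : Ω ⊆ {z : ℝ × ℝ | z ∉ K ∧ Metric.infDist z K < ε}) :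
    ∃ O, IsOpen O ∧ (∀ z, ε ≤ Metric.infDist z K → z ∈ O) ∧
      (∀ θ m, 0 < m → tangentPt p θ m ∈ O → tangentPt p θ (-m) ∈ O) ∧
      ∃ δ > 0, Disjoint (Metric.thickening δ K) O := by
  obtain ⟨hΩK, hΩc, hΦΩ, ℓ, -, hnull, hℓ⟩ := h
  obtain ⟨k₀, hk₀int, -⟩ := S.exists_dot_lt
  have hk₀ := interior_subset hk₀int
  have hne : K.Nonempty := ⟨k₀, hk₀⟩
  have hthick : ∀ (δ : ℝ) (z : ℝ × ℝ), z ∈ Metric.thickening δ K ↔ Metric.infDist z K < δ :=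
    fun δ z => Metric.mem_thickening_iff_infDist_lt hne
  have hCconv : Convex ℝ (Metric.thickening ε K) := S.convex.thickening ε
  have hCb : Bornology.IsBounded (Metric.thickening ε K) := S.compact.isBounded.thickening
  have hD : (Metric.thickening ε K)ᶜ ⊆ Ωᶜ := fun z hz hzΩ => hz ((hthick ε z).2 (hΩ hzΩ).2)
  obtain ⟨R₀, hR₀⟩ := hCb.exists_norm_le
  obtain ⟨M, hM⟩ := S.compact.isBounded.exists_norm_le
  have hM0 : 0 ≤ M := (norm_nonneg _).trans (hM _ hk₀)
  let φ : C(AddCircle (2 * π), ℂ) := ⟨fun x => Complex.equivRealProdCLM.symm (ℓ x).1, by fun_prop⟩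
  obtain ⟨B, hB⟩ : ∃ B, ∀ x, ‖φ x‖ ≤ B := by
    have : Fact (0 < 2 * π) := ⟨two_pi_pos⟩
    obtain ⟨B, hB⟩ := (isCompact_range φ.continuous).isBounded.exists_norm_le
    exact ⟨B, fun x => hB _ ⟨x, rfl⟩⟩
  set t := |R₀| + |B| + 2 * M + 1 with ht
  have ht0 : 0 < t := by positivity
  set z₀ : ℝ × ℝ := (t, 0) with hz₀
  have hz₀n : ‖z₀‖ = t := by
    rw [hz₀, Prod.norm_mk, norm_zero, norm_of_nonneg ht0.le, max_eq_left ht0.le]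
  have hz₀D : z₀ ∈ (Metric.thickening ε K)ᶜ := fun hz => by
    have := hR₀ z₀ hz
    rw [hz₀n] at this
    linarith [le_abs_self R₀, abs_nonneg B]
  have hz₀Ω := hD hz₀D
  set O := connectedComponentIn Ωᶜ z₀ with hO
  have hOpre : IsPreconnected O := isPreconnected_connectedComponentIn
  have hOΩ : O ⊆ Ωᶜ := connectedComponentIn_subset _ _
  have hz₀O : z₀ ∈ O := mem_connectedComponentIn hz₀Ω
  have hDO : (Metric.thickening ε K)ᶜ ⊆ O :=
    (isPreconnected_compl_of_convex hCconv hCb).subset_connectedComponentIn hz₀D hD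
  have habs : ∀ s : Set (ℝ × ℝ), IsPreconnected s → s ⊆ Ωᶜ → (s ∩ O).Nonempty → s ⊆ O := by
    rintro s hs hsΩ ⟨z, hzs, hzO⟩
    rw [hO, connectedComponentIn_eq hzO]
    exact hs.subset_connectedComponentIn hzs hsΩ
  have hk₀O : k₀ ∉ O := by
    intro hmem
    have : Fact (0 < 2 * π) := ⟨two_pi_pos⟩
    have hdisj : Disjoint (Complex.equivRealProdCLM.symm '' O) (Set.range φ) := by
      rw [Set.disjoint_left]
      rintro _ ⟨z, hz, rfl⟩ ⟨x, hx⟩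
      have : (ℓ x).1 = z := Complex.equivRealProdCLM.symm.injective hx
      exact hOΩ hz (by rw [hℓ, ← this]; exact ⟨_, ⟨x, rfl⟩, rfl⟩)
    have hfar : ∀ x, ‖φ x‖ < ‖Complex.equivRealProdCLM.symm z₀‖ := fun x => by
      have : t ≤ ‖Complex.equivRealProdCLM.symm z₀‖ := by
        refine le_trans ?_ (Complex.re_le_norm _)
        simp [hz₀]
      linarith [hB x, le_abs_self B, abs_nonneg R₀]
    obtain ⟨f, hf⟩ := exists_log_sub_of_isPreconnected φ
      (hOpre.image Complex.equivRealProdCLM.symm (by fun_prop)) hdisj ⟨z₀, hz₀O, rfl⟩ hfar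
      ⟨k₀, hmem, rfl⟩
    refine hnull (nullhomotopic_of_exists_log S.convex S.compact.isBounded hk₀ ℓ f fun x => ?_)
    rw [hf, map_sub]
    rfl
  obtain ⟨δ, hδ, hδd⟩ : ∃ δ, 0 < δ ∧ Disjoint (Metric.thickening δ K) (Metric.thickening δ Ω) :=
    (Set.disjoint_left.2 fun z hz hzΩ => hΩK hzΩ hz : Disjoint K Ω).exists_thickenings
      S.compact hΩc.isClosed
  have hδO : Disjoint (Metric.thickening δ K) O := by
    rw [Set.disjoint_iff_inter_eq_empty, ← Set.not_nonempty_iff_eq_empty]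
    intro hne'
    exact hk₀O (habs _ (S.convex.thickening δ).isPreconnected (fun z hz hzΩ =>
      Set.disjoint_left.1 hδd hz (Metric.self_subset_thickening hδ _ hzΩ)) hne'
      (Metric.self_subset_thickening hδ _ hk₀))
  have hOK : O ⊆ Kᶜ := fun z hz hzK =>
    Set.disjoint_left.1 hδO (Metric.self_subset_thickening hδ _ hzK) hz
  refine ⟨O, hΩc.isClosed.isOpen_compl.connectedComponentIn, fun z hz => hDO ?_, ?_, δ, hδ, hδO⟩
  · rw [Set.mem_compl_iff, hthick]; exact hz.not_gt
  obtain ⟨β, hβc, hβ'⟩ := S.exists_contact (Or.inl rfl)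
  have hβ : ∀ θ m, 0 < m → β (tangentPt p θ m) = tangentPt p θ 0 := fun θ m hm => by
    rw [← hβ' θ m hm, one_mul]
  have hg : ∀ θ m, 0 < m →
      β (tangentPt p θ m) + β (tangentPt p θ m) - tangentPt p θ m = tangentPt p θ (-m) := by
    intro θ m hm
    rw [hβ θ m hm, tangentPt_eq_add_smul p θ m, tangentPt_eq_add_smul p θ (-m), neg_smul]; abel
  have hgc : ContinuousOn (fun z => β z + β z - z) O := by
    have := hβc.mono hOK
    fun_prop
  have himg : (fun z => β z + β z - z) '' O ⊆ O := by
    refine habs _ (hOpre.image _ hgc) ?_ ⟨_, ⟨z₀, hz₀O, rfl⟩, hDO fun hmem => ?_⟩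
    · rintro _ ⟨z, hz, rfl⟩ hzΩ
      obtain ⟨θ, m, hm, rfl⟩ := S.exists_tangentPt_eq (Or.inl rfl) (hOK hz)
      simp only [one_mul] at hz hzΩ
      rw [hg θ m hm] at hzΩ
      refine hOΩ hz ?_
      rw [← hΦΩ, ← hΦ θ m hm]
      exact ⟨_, hzΩ, rfl⟩
    · obtain ⟨θ, m, hm, e⟩ := S.exists_tangentPt_eq (Or.inl rfl) (hOK hz₀O)
      have h1 := hR₀ _ hmem
      have h2 : ‖β z₀‖ ≤ M := by
        rw [e, one_mul, hβ θ m hm]; exact hM _ (S.tangentPt_zero_mem θ)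
      have h3 := norm_sub_le (β z₀ + β z₀) (β z₀ + β z₀ - z₀)
      have h4 := norm_add_le (β z₀) (β z₀)
      rw [sub_sub_cancel, hz₀n] at h3
      linarith [le_abs_self R₀, abs_nonneg B]
  intro θ m hm hmem
  exact himg ⟨_, hmem, hg θ m hm⟩

theorem hasFDerivAt_tangentPt {p : ℝ → ℝ} {q : ℝ × ℝ} (σ : ℝ) (hp : DifferentiableAt ℝ p q.1)
    (hp' : DifferentiableAt ℝ (deriv p) q.1) :
    HasFDerivAt (fun q : ℝ × ℝ => tangentPt p q.1 (σ * q.2))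
      (LinearMap.toContinuousLinearMap (Matrix.toLin (Module.Basis.finTwoProd ℝ)
        (Module.Basis.finTwoProd ℝ)
        !![-(p q.1 + deriv (deriv p) q.1) * sin q.1 - σ * q.2 * cos q.1, -σ * sin q.1;
          (p q.1 + deriv (deriv p) q.1) * cos q.1 - σ * q.2 * sin q.1, σ * cos q.1])) q := by
  rw [Matrix.toLin_finTwoProd_toContinuousLinearMap]
  have h1 := hp.hasDerivAt.comp_hasFDerivAt q (f := Prod.fst) (hasFDerivAt_fst (𝕜 := ℝ))
  have h2 := hp'.hasDerivAt.comp_hasFDerivAt q (f := Prod.fst) (hasFDerivAt_fst (𝕜 := ℝ))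
  have hc := (hasDerivAt_cos q.1).comp_hasFDerivAt q (f := Prod.fst) (hasFDerivAt_fst (𝕜 := ℝ))
  have hs := (hasDerivAt_sin q.1).comp_hasFDerivAt q (f := Prod.fst) (hasFDerivAt_fst (𝕜 := ℝ))
  have hl := (hasFDerivAt_snd (𝕜 := ℝ) (p := q)).const_mul σ
  have h := ((h1.mul hc).sub ((h2.add hl).mul hs)).prodMk ((h1.mul hs).add ((h2.add hl).mul hc))
  refine h.congr_fderiv ?_
  ext <;> simp <;> ring

theorem differentiableAt_tangentLine {p : ℝ → ℝ} {q : ℝ × ℝ} (hp : DifferentiableAt ℝ p q.1) :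
    DifferentiableAt ℝ (fun q : ℝ × ℝ =>
      (p q.1 * cos q.1 - q.2 * sin q.1, p q.1 * sin q.1 + q.2 * cos q.1)) q := by
  have : DifferentiableAt ℝ (fun q : ℝ × ℝ => p q.1) q :=
    DifferentiableAt.comp (f := Prod.fst) q hp differentiableAt_fst
  fun_prop

namespace SupportData

variable {K : Set (ℝ × ℝ)} {p : ℝ → ℝ}

/-- Area in tangential coordinates. -/
theorem volume_eq_lintegral (S : SupportData K p) {σ : ℝ} (hσ : σ = 1 ∨ σ = -1) (a : ℝ)
    {B : Set (ℝ × ℝ)} (hB : MeasurableSet B) (hBK : B ⊆ Kᶜ) :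
    ∫⁻ q in (Set.Ioc a (a + 2 * π) ×ˢ Set.Ioi 0) ∩
      (fun q : ℝ × ℝ => tangentPt p q.1 (σ * q.2)) ⁻¹' B, ENNReal.ofReal q.2 = volume B := by
  have hσσ : σ * σ = 1 := by rcases hσ with rfl | rfl <;> norm_num
  set f : ℝ × ℝ → ℝ × ℝ := fun q => tangentPt p q.1 (σ * q.2) with hf
  have hfc : Continuous f := (continuous_tangentPt S.differentiable.continuous
    S.continuous_deriv).comp (f := fun q : ℝ × ℝ => (q.1, σ * q.2)) (by fun_prop)
  set D := {θ | DifferentiableAt ℝ (deriv p) θ} with hD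
  have hDm : MeasurableSet D := measurableSet_of_differentiableAt ℝ (deriv p)
  have hDnull : volume Dᶜ = 0 := by
    obtain ⟨L, hL⟩ := S.lipschitz
    have := hL.ae_differentiableAt_real
    rwa [ae_iff] at this
  set G := (Set.Ioc a (a + 2 * π) ×ˢ Set.Ioi 0) ∩ f ⁻¹' B with hG
  have hGm : MeasurableSet G :=
    (measurableSet_Ioc.prod measurableSet_Ioi).inter (hfc.measurable hB)
  have hPm : MeasurableSet (D ×ˢ (Set.univ : Set ℝ)) := hDm.prod MeasurableSet.univ
  have hPnull : volume (Dᶜ ×ˢ (Set.univ : Set ℝ)) = 0 := by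
    rw [Measure.volume_eq_prod, Measure.prod_prod, hDnull, zero_mul]
  have hinj : Set.InjOn f G := by
    rintro ⟨θ, l⟩ ⟨⟨hθ, hl⟩, -⟩ ⟨θ', l'⟩ ⟨⟨hθ', hl'⟩, -⟩ e
    simp only [Set.mem_Ioc, Set.mem_Ioi] at hθ hθ' hl hl'
    obtain ⟨⟨n, hn⟩, rfl⟩ := S.tangentPt_inj_mod hσ hl hl' e
    have hn0 : n = 0 := by
      have h1 : (n : ℝ) < 1 := by
        by_contra! h
        nlinarith [pi_pos]
      have h2 : (-1 : ℝ) < n := by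
        by_contra! h
        nlinarith [pi_pos]
      have h1' : n < 1 := by exact_mod_cast h1
      have h2' : -1 < n := by exact_mod_cast h2
      omega
    simp only [hn0, Int.cast_zero, zero_mul, add_zero] at hn
    rw [hn]
  have himg : f '' G = B := by
    refine Set.Subset.antisymm (Set.image_subset_iff.2 fun q hq => hq.2) fun z hz => ?_
    obtain ⟨θ, l, hl, rfl⟩ := S.exists_tangentPt_eq hσ (hBK hz)
    have e : f (toIocMod two_pi_pos a θ, l) = tangentPt p θ (σ * l) := by
      have : toIocMod two_pi_pos a θ = θ + (-toIocDiv two_pi_pos a θ : ℤ) * (2 * π) := by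
        rw [toIocMod, zsmul_eq_mul]; push_cast; ring
      simp only [hf]
      rw [this, S.tangentPt_add_int]
    refine ⟨(toIocMod two_pi_pos a θ, l), ⟨⟨toIocMod_mem_Ioc two_pi_pos a θ, hl⟩, ?_⟩, e⟩
    rw [Set.mem_preimage, e]
    exact hz
  have hnull : volume (f '' (G \ D ×ˢ Set.univ)) = 0 := by
    refine measure_mono_null (t := (fun q : ℝ × ℝ => (p q.1 * cos q.1 - q.2 * sin q.1,
      p q.1 * sin q.1 + q.2 * cos q.1)) '' (Dᶜ ×ˢ Set.univ)) ?_
      (addHaar_image_eq_zero_of_differentiableOn_of_addHaar_eq_zero volume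
        (fun q _ => (differentiableAt_tangentLine
          (S.differentiable q.1)).differentiableWithinAt) hPnull)
    rintro _ ⟨⟨θ, l⟩, ⟨-, h⟩, rfl⟩
    exact ⟨(θ, deriv p θ + σ * l), ⟨fun h' => h ⟨h', trivial⟩, trivial⟩, rfl⟩
  have hmain := lintegral_abs_det_fderiv_eq_addHaar_image volume (hGm.inter hPm)
    (fun q hq => (hasFDerivAt_tangentPt σ (S.differentiable q.1) hq.2.1).hasFDerivWithinAt)
    (hinj.mono Set.inter_subset_left)
  have hGnull : volume (G \ D ×ˢ Set.univ) = 0 := measure_mono_null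
    (t := Dᶜ ×ˢ Set.univ) (fun q hq => ⟨fun h => hq.2 ⟨h, trivial⟩, trivial⟩) hPnull
  rw [← lintegral_inter_add_sdiff (μ := volume) _ G hPm, setLIntegral_measure_zero _ _ hGnull,
    add_zero]
  have hvol : volume B = volume (f '' (G ∩ D ×ˢ Set.univ)) := by
    refine le_antisymm ?_ (measure_mono ((Set.image_mono Set.inter_subset_left).trans himg.le))
    rw [← himg]
    nth_rewrite 1 [← Set.inter_union_sdiff G (D ×ˢ Set.univ)]
    rw [Set.image_union]
    exact (measure_union_le _ _).trans (by rw [hnull, add_zero])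
  rw [hvol, ← hmain]
  refine setLIntegral_congr_fun (hGm.inter hPm) fun q hq => ?_
  have hl : 0 < q.2 := hq.1.1.2
  have hdet : (-(p q.1 + deriv (deriv p) q.1) * sin q.1 - σ * q.2 * cos q.1) * (σ * cos q.1) -
      -σ * sin q.1 * ((p q.1 + deriv (deriv p) q.1) * cos q.1 - σ * q.2 * sin q.1) = -q.2 := by
    have hsc := sin_sq_add_cos_sq q.1
    linear_combination (-(σ * σ * q.2)) * hsc - q.2 * hσσ
  simp only [ContinuousLinearMap.det, LinearMap.coe_toContinuousLinearMap, LinearMap.det_toLin,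
    Matrix.det_fin_two_of, hdet, abs_neg, abs_of_pos hl]

/-- Area preservation: the dual billiard map cannot carry a bounded set `B` into itself while
leaving an open part of `B` uncovered. -/
theorem false_of_area (S : SupportData K p) {B : Set (ℝ × ℝ)} (hB : MeasurableSet B)
    (hBK : B ⊆ Kᶜ) (hfin : volume B ≠ ⊤) (a : ℝ)
    (hinv : ∀ θ l, 0 < l → tangentPt p θ (-l) ∈ B → tangentPt p θ l ∈ B) {E : Set (ℝ × ℝ)}
    (hE : IsOpen E) (hne : E.Nonempty)
    (hEB : ∀ q ∈ E, q.1 ∈ Set.Ioc a (a + 2 * π) ∧ 0 < q.2 ∧ tangentPt p q.1 (-q.2) ∉ B ∧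
      tangentPt p q.1 q.2 ∈ B) : False := by
  have h1 := S.volume_eq_lintegral (Or.inl rfl) a hB hBK
  have h2 := S.volume_eq_lintegral (Or.inr rfl) a hB hBK
  simp only [one_mul, neg_one_mul] at h1 h2
  set G₁ := (Set.Ioc a (a + 2 * π) ×ˢ Set.Ioi 0) ∩
    (fun q : ℝ × ℝ => tangentPt p q.1 q.2) ⁻¹' B with hG₁
  set G₂ := (Set.Ioc a (a + 2 * π) ×ˢ Set.Ioi 0) ∩
    (fun q : ℝ × ℝ => tangentPt p q.1 (-q.2)) ⁻¹' B with hG₂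
  have hdisj : Disjoint G₂ E := Set.disjoint_left.2 fun q hq hqE => (hEB q hqE).2.2.1 hq.2
  have hsub : G₂ ∪ E ⊆ G₁ := by
    rintro q (hq | hq)
    · exact ⟨hq.1, hinv q.1 q.2 hq.1.2 hq.2⟩
    · obtain ⟨ha, hl, -, hb⟩ := hEB q hq
      exact ⟨⟨ha, hl⟩, hb⟩
  have h3 := lintegral_mono_set (μ := volume) (f := fun q : ℝ × ℝ => ENNReal.ofReal q.2) hsub
  rw [lintegral_union hE.measurableSet hdisj, h1, h2] at h3
  have h4 : ∫⁻ q in E, ENNReal.ofReal q.2 = 0 := by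
    by_contra h
    exact (ENNReal.lt_add_right hfin h).not_ge h3
  have h5 : 0 < ∫⁻ q in E, ENNReal.ofReal q.2 := by
    rw [setLIntegral_pos_iff (by fun_prop)]
    refine (hE.measure_pos volume hne).trans_le (measure_mono fun q hq => ⟨?_, hq⟩)
    rw [Function.mem_support]
    exact (ENNReal.ofReal_pos.2 (hEB q hq).2.1).ne'
  exact (h5.trans_eq h4).false

/-- Two supporting directions on either side of `θ`, less than `π` apart, which miss the contact
point at `θ`. -/
theorem exists_backLen_pos_fwdLen_pos (S : SupportData K p) (θ : ℝ) :
    ∃ a b, a < θ ∧ θ < b ∧ b < a + π ∧ 0 < backLen p a θ ∧ 0 < fwdLen p θ b := by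
  obtain ⟨k, -, hk⟩ := S.exists_dot_lt
  set x := tangentPt p θ 0 with hx
  have hxθ : x.1 * cos θ + x.2 * sin θ = p θ := by rw [hx, tangentPt_dot]; simp
  have hc : Continuous fun s : ℝ => (k.1 - x.1) * cos (θ + s) + (k.2 - x.2) * sin (θ + s) := by
    fun_prop
  obtain ⟨s, ⟨hs0, hsπ⟩, hs⟩ := intermediate_value_Ioo pi_pos.le hc.continuousOn
    (show (0 : ℝ) ∈ Set.Ioo _ _ by
      constructor
      · have := hk θ
        simp only [add_zero]; linarith
      · have := hk θ
        simp only [cos_add_pi, sin_add_pi]; linarith)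
  simp only at hs
  have hg₁ : 0 < p (θ + s) - (x.1 * cos (θ + s) + x.2 * sin (θ + s)) := by
    linarith [hk (θ + s)]
  have hg₂ : 0 < p (θ + s - π) - (x.1 * cos (θ + s - π) + x.2 * sin (θ + s - π)) := by
    have := hk (θ + s - π)
    rw [cos_sub_pi, sin_sub_pi] at this ⊢
    linarith
  have hgc : Continuous fun φ => p φ - (x.1 * cos φ + x.2 * sin φ) := by
    have := S.differentiable.continuous
    fun_prop
  obtain ⟨b, hb1, hb2, hb3⟩ := (((hgc.continuousAt.eventually_const_lt hg₁).filter_mono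
    nhdsWithin_le_nhds).and (Ioo_mem_nhdsLT (by linarith : θ < θ + s))).exists
  have hsa : 0 < sin (θ - (θ + s - π)) := sin_sub_pos (by linarith) (by linarith)
  have hsb : 0 < sin (b - θ) := sin_sub_pos hb2 (by linarith)
  refine ⟨θ + s - π, b, by linarith, hb2, by linarith, ?_, ?_⟩
  · by_contra! h
    have h0 := S.backLen_nonneg hsa
    have e := tangentPt_fwdLen_eq p hsa.ne'
    rw [le_antisymm h h0, neg_zero, ← hx] at e
    rw [← e, tangentPt_dot] at hg₂
    simp at hg₂
  · by_contra! h
    have h0 := S.fwdLen_nonneg hsb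
    have e := tangentPt_fwdLen_eq p hsb.ne'
    rw [le_antisymm h h0, ← hx] at e
    rw [e, tangentPt_dot] at hb1
    simp at hb1

theorem hasDerivAt_fwdLen {θ b : ℝ} (hp : DifferentiableAt ℝ p θ)
    (hd : HasDerivAt (deriv p) (-p θ) θ) (h : sin (b - θ) ≠ 0) :
    HasDerivAt (fun t => fwdLen p t b) (fwdLen p θ b * cos (b - θ) / sin (b - θ)) θ := by
  have hs : HasDerivAt (fun t => sin (b - t)) (cos (b - θ) * -1) θ :=
    (hasDerivAt_sin (b - θ)).comp θ ((hasDerivAt_id θ).const_sub b)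
  have hc : HasDerivAt (fun t => cos (b - t)) (-sin (b - θ) * -1) θ :=
    (hasDerivAt_cos (b - θ)).comp θ ((hasDerivAt_id θ).const_sub b)
  refine ((((hp.hasDerivAt.mul hc).const_sub (p b)).sub (hd.mul hs)).div hs h).congr_deriv ?_
  simp only [fwdLen, Pi.sub_apply, Pi.mul_apply]
  field_simp
  ring

theorem hasDerivAt_backLen {θ a : ℝ} (hp : DifferentiableAt ℝ p θ)
    (hd : HasDerivAt (deriv p) (-p θ) θ) (h : sin (θ - a) ≠ 0) :
    HasDerivAt (fun t => backLen p a t) (-(backLen p a θ * cos (θ - a) / sin (θ - a))) θ := by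
  have hs : HasDerivAt (fun t => sin (t - a)) (cos (θ - a)) θ :=
    (hasDerivAt_sin (θ - a)).comp_sub_const θ a
  have hc : HasDerivAt (fun t => cos (t - a)) (-sin (θ - a)) θ :=
    (hasDerivAt_cos (θ - a)).comp_sub_const θ a
  refine ((((hp.hasDerivAt.mul hc).const_sub (p a)).add (hd.mul hs)).div hs h).congr_deriv ?_
  simp only [backLen, Pi.add_apply, Pi.mul_apply]
  field_simp
  ring

/-- At a direction of vanishing curvature radius, the tangents at `a` and `b` cut off a longer
forward than backward tangent segment at directions slightly larger than `θ`. -/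
theorem eventually_backLen_lt_fwdLen {θ a b r : ℝ} (hp : DifferentiableAt ℝ p θ)
    (hd : HasDerivAt (deriv p) (-p θ) θ) (ha : a < θ) (hb : θ < b) (hab : b < a + π) (hr : 0 < r)
    (har : backLen p a θ = r) (hbr : fwdLen p θ b = r) :
    ∀ᶠ t in 𝓝[>] θ, backLen p a t < fwdLen p t b := by
  have h1 : 0 < sin (b - θ) := sin_sub_pos hb (by linarith)
  have h2 : 0 < sin (θ - a) := sin_sub_pos ha (by linarith)
  have h3 : 0 < sin (b - a) := sin_sub_pos (ha.trans hb) hab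
  have hF := (hasDerivAt_fwdLen hp hd h1.ne').sub (hasDerivAt_backLen hp hd h2.ne')
  have hpos : 0 < fwdLen p θ b * cos (b - θ) / sin (b - θ) -
      -(backLen p a θ * cos (θ - a) / sin (θ - a)) := by
    have e : fwdLen p θ b * cos (b - θ) / sin (b - θ) -
        -(backLen p a θ * cos (θ - a) / sin (θ - a)) =
        r * sin (b - a) / (sin (b - θ) * sin (θ - a)) := by
      rw [har, hbr, show b - a = (b - θ) + (θ - a) by ring, sin_add]
      field_simp
      ring
    rw [e]; positivity
  have := (hF.tendsto_slope.mono_left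
    (nhdsWithin_mono θ fun t (ht : θ < t) => ht.ne')).eventually_const_lt hpos
  filter_upwards [this, self_mem_nhdsWithin] with t ht (htθ : θ < t)
  simp only [slope_def_field, Pi.sub_apply, har, hbr, sub_self, sub_zero] at ht
  have := (lt_div_iff₀ (by linarith)).1 ht
  linarith

/-- Tangents at `a` and `b` cutting off equal segments of the tangent line at a direction of
vanishing curvature radius cannot touch the inner boundary of an invariant radial region. -/
theorem false_of_radial (S : SupportData K p) {N : Set (ℝ × ℝ)} (hN : IsOpen N)
    (hNb : Bornology.IsBounded Nᶜ)
    (hbwd : ∀ θ l l', tangentPt p θ (-l) ∈ N → 0 < l → l ≤ l' → tangentPt p θ (-l') ∈ N)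
    (hfwd : ∀ θ l l', tangentPt p θ l ∈ N → 0 < l → l ≤ l' → tangentPt p θ l' ∈ N)
    (hinv : ∀ θ m, 0 < m → tangentPt p θ m ∈ N → tangentPt p θ (-m) ∈ N) {θ a b r : ℝ}
    (hd : HasDerivAt (deriv p) (-p θ) θ) (hr : 0 < r) (hrN : tangentPt p θ (-r) ∉ N)
    (hrN' : ∀ s, r < s → tangentPt p θ (-s) ∈ N) (ha : a < θ) (hb : θ < b) (hab : b < a + π)
    (har : backLen p a θ = r) (hbr : fwdLen p θ b = r) : False := by
  have hp := S.differentiable.continuous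
  have hp' := S.continuous_deriv
  have hback : ∀ t ∈ Set.Ioo θ b, ∀ l, backLen p a t < l → tangentPt p t (-l) ∈ N := by
    intro t ht l hl
    have hc : ContinuousAt (fun x => backLen p x t) a :=
      ContinuousAt.comp (g := fun q : ℝ × ℝ => backLen p q.1 q.2) (f := fun x : ℝ => (x, t))
        (continuousAt_backLen hp hp' (sin_sub_pos (ha.trans ht.1) (ht.2.trans hab)).ne')
        (by fun_prop)
    obtain ⟨x, hxl, hx, hxa⟩ := (((hc.eventually_lt_const hl).filter_mono
      nhdsWithin_le_nhds).and (Ioo_mem_nhdsLT (by linarith [ht.2] : t - π < a))).exists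
    have hxθ : 0 < sin (θ - x) := sin_sub_pos (hxa.trans ha) (by linarith [ht.1])
    have hxt : 0 < sin (t - x) := sin_sub_pos (by linarith [ht.1]) (by linarith)
    have haθ : 0 < sin (θ - a) := sin_sub_pos ha (by linarith)
    have hle : r ≤ backLen p x θ :=
      har ▸ S.backLen_anti (by linarith [ht.1]) hxa.le ha
    have hfx : 0 < fwdLen p x θ := (S.fwdLen_pos_iff hxθ).2 (hr.trans_le hle)
    have hfa : 0 < fwdLen p a θ := (S.fwdLen_pos_iff haθ).2 (har ▸ hr)
    have hlt : r < backLen p x θ := by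
      refine hle.lt_of_ne fun h => ?_
      have e := tangentPt_fwdLen_eq p hxθ.ne'
      rw [← h, ← har, ← tangentPt_fwdLen_eq p haθ.ne', ← one_mul (fwdLen p x θ),
        ← one_mul (fwdLen p a θ)] at e
      obtain ⟨⟨n, hn⟩, -⟩ := S.tangentPt_inj_mod (Or.inl rfl) hfx hfa e
      have h0 : 0 < n := by
        by_contra! h0
        have : (n : ℝ) ≤ 0 := by exact_mod_cast h0
        nlinarith [pi_pos]
      have h1 : (1 : ℝ) ≤ n := by exact_mod_cast h0
      nlinarith [pi_pos, ht.1]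
    have h1 := hrN' _ hlt
    rw [← tangentPt_fwdLen_eq p hxθ.ne'] at h1
    have hmono := S.fwdLen_mono (hxa.trans ha) ht.1.le (by linarith : t < x + π)
    have h2 := hfwd _ _ _ h1 hfx hmono
    rw [tangentPt_fwdLen_eq p hxt.ne'] at h2
    exact hbwd _ _ _ h2 ((S.fwdLen_pos_iff hxt).1 (hfx.trans_le hmono)) hxl.le
  have hforw : ∀ t ∈ Set.Ioo θ b, ∀ l, 0 < l → l < fwdLen p t b → tangentPt p t l ∉ N := by
    intro t ht l hl hlt h
    have htb : 0 < sin (b - t) := sin_sub_pos ht.2 (by linarith [ht.1])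
    have hθb : 0 < sin (b - θ) := sin_sub_pos hb (by linarith)
    have h1 := hfwd _ _ _ h hl hlt.le
    rw [tangentPt_fwdLen_eq p htb.ne'] at h1
    have h2 := hbwd _ _ _ h1 ((S.fwdLen_pos_iff htb).1 (hl.trans hlt))
      (S.backLen_anti (by linarith) ht.1.le ht.2)
    rw [← tangentPt_fwdLen_eq p hθb.ne', hbr] at h2
    exact hrN (hinv _ _ hr h2)
  obtain ⟨t, hlt, ht⟩ := ((eventually_backLen_lt_fwdLen (S.differentiable θ) hd ha hb hab hr har
    hbr).and (Ioo_mem_nhdsGT hb)).exists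
  obtain ⟨m, hm1, hm2⟩ := exists_between hlt
  have hc₁ : ContinuousAt (fun q : ℝ × ℝ => backLen p a q.1) (t, m) :=
    ContinuousAt.comp (g := fun q : ℝ × ℝ => backLen p q.1 q.2) (f := fun q : ℝ × ℝ => (a, q.1))
      (continuousAt_backLen hp hp' (sin_sub_pos (ha.trans ht.1) (ht.2.trans hab)).ne')
      (by fun_prop)
  have hc₂ : ContinuousAt (fun q : ℝ × ℝ => fwdLen p q.1 b) (t, m) :=
    ContinuousAt.comp (g := fun q : ℝ × ℝ => fwdLen p q.1 q.2) (f := fun q : ℝ × ℝ => (q.1, b))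
      (continuousAt_fwdLen hp hp' (sin_sub_pos ht.2 (by linarith [ht.1])).ne')
      (by fun_prop)
  have hE : {q : ℝ × ℝ | q.1 ∈ Set.Ioo θ b ∧ backLen p a q.1 < q.2 ∧ q.2 < fwdLen p q.1 b} ∈
      𝓝 (t, m) :=
    (continuousAt_fst.eventually_mem (Ioo_mem_nhds ht.1 ht.2)).and
      ((hc₁.eventually_lt continuousAt_snd hm1).and (continuousAt_snd.eventually_lt hc₂ hm2))
  refine S.false_of_area (B := (K ∪ N)ᶜ) (S.compact.measurableSet.union hN.measurableSet).compl
    (Set.compl_subset_compl.2 Set.subset_union_left)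
    (hNb.subset (Set.compl_subset_compl.2 Set.subset_union_right)).measure_lt_top.ne (θ - π)
    ?_ isOpen_interior ⟨_, mem_interior_iff_mem_nhds.2 hE⟩ ?_
  · rintro φ l hl h (h' | h')
    · exact S.tangentPt_notMem hl.ne' h'
    · exact h (Or.inr (hinv _ _ hl h'))
  · intro q hq
    obtain ⟨⟨h1, h2⟩, h3, h4⟩ := interior_subset hq
    have h0 : 0 < q.2 :=
      (S.backLen_nonneg (sin_sub_pos (ha.trans h1) (h2.trans hab))).trans_lt h3
    refine ⟨⟨by linarith [pi_pos], by linarith⟩, h0,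
      fun h => h (Or.inr (hback _ ⟨h1, h2⟩ _ h3)), ?_⟩
    rintro (h | h)
    · exact S.tangentPt_notMem h0.ne' h
    · exact hforw _ ⟨h1, h2⟩ _ h0 h4 h

/-- A direction of vanishing curvature radius prevents invariant circles near the table. -/
theorem exists_no_invCircle (S : SupportData K p) {Φ : ℝ × ℝ → ℝ × ℝ}
    (hΦ : ∀ θ l, 0 < l → Φ (tangentPt p θ (-l)) = tangentPt p θ l) {θ : ℝ}
    (hd : HasDerivAt (deriv p) (-p θ) θ) :
    ∃ ε : ℝ, 0 < ε ∧ ∀ Ω : Set (ℝ × ℝ), DBInvCircle K Φ Ω →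
      ¬ (Ω ⊆ {z : ℝ × ℝ | z ∉ K ∧ Metric.infDist z K < ε}) := by
  obtain ⟨α, β, hα, hβ, hαβ, hαl, hβl⟩ := S.exists_backLen_pos_fwdLen_pos θ
  set l₀ := min (backLen p α θ) (fwdLen p θ β) / 2 with hl₀
  have hl₀0 : 0 < l₀ := half_pos (lt_min hαl hβl)
  have hl₀α : l₀ < backLen p α θ :=
    (half_lt_self (lt_min hαl hβl)).trans_le (min_le_left _ _)
  have hl₀β : l₀ < fwdLen p θ β :=
    (half_lt_self (lt_min hαl hβl)).trans_le (min_le_right _ _)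
  have hne : K.Nonempty := ⟨_, S.tangentPt_zero_mem θ⟩
  set ε := Metric.infDist (tangentPt p θ (-l₀)) K
  have hε : 0 < ε :=
    (S.compact.isClosed.notMem_iff_infDist_pos hne).1 (S.tangentPt_notMem (by linarith))
  refine ⟨ε, hε, ?_⟩
  intro Ω hΩ hΩε
  obtain ⟨O, hO, hεO, hOinv, δ, hδ, hδO⟩ := hΩ.exists_outer S hΦ hΩε
  obtain ⟨M, hM⟩ := S.compact.isBounded.exists_norm_le
  obtain ⟨B₁, hB₁⟩ := (S.compact.isBounded.thickening (δ := ε)).exists_norm_le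
  obtain ⟨B₂, hB₂⟩ := (S.compact.isBounded.thickening (δ := δ)).exists_norm_le
  have hKδ := Metric.self_subset_thickening hδ K
  have hKO : Disjoint K O := hδO.mono_left hKδ
  have hεO' : (Metric.thickening ε K)ᶜ ⊆ O := fun z hz => hεO z <| by
    rwa [Set.mem_compl_iff, Metric.mem_thickening_iff_infDist_lt hne, not_lt] at hz
  set R₀ := max M B₁
  set R := max (R₀ + 2 * M) B₂
  have hM0 : 0 ≤ M := (norm_nonneg _).trans (hM _ (S.tangentPt_zero_mem θ))
  have hMR : M ≤ R := (le_max_left M B₁).trans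
    ((by linarith : R₀ ≤ R₀ + 2 * M).trans (le_max_left _ _))
  have hR₀ : ∀ z : ℝ × ℝ, R₀ < ‖z‖ → z ∈ O := fun z hz =>
    hεO' fun h => ((hB₁ z h).trans (le_max_right _ _)).not_gt hz
  set N := {z | Swept p O R z} with hN
  have hNo : IsOpen N := Swept.isOpen S hO hKO fun z hz => (hM z hz).trans hMR
  have hNδ : ∀ z ∈ N, z ∉ Metric.thickening δ K := fun z hz =>
    Swept.notMem_of_convex S (S.convex.thickening δ) hKδ hδO
      (fun z hz => (hB₂ z hz).trans (le_max_right _ _)) hz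
  have hNinv : ∀ φ m, 0 < m → tangentPt p φ m ∈ N → tangentPt p φ (-m) ∈ N := fun φ m hm h =>
    Swept.bwd_of_fwd S hO hKO hOinv hM (le_max_left _ _) hR₀ (le_max_left _ _) hm h
  have hNb : Bornology.IsBounded Nᶜ := isBounded_iff_forall_norm_le.2
    ⟨R, fun z hz => not_lt.1 fun h => hz (Swept.far h)⟩
  set s := {l | 0 < l ∧ tangentPt p θ (-l) ∈ N} with hs
  have hl₀s : l₀ ∈ s := by
    refine ⟨hl₀0, ?_⟩
    refine Swept.of_notMem_convex S (S.convex.thickening ε)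
      (Metric.self_subset_thickening hε K) hεO' ?_
    rw [Metric.mem_thickening_iff_infDist_lt hne]
    exact lt_irrefl _
  have hsb : BddBelow s := ⟨0, fun l hl => hl.1.le⟩
  set r := sInf s with hr
  have hrl₀ : r ≤ l₀ := csInf_le hsb hl₀s
  have hrN' : ∀ l, r < l → tangentPt p θ (-l) ∈ N := fun l hl => by
    obtain ⟨l', hl's, hl'⟩ := exists_lt_of_csInf_lt ⟨l₀, hl₀s⟩ hl
    exact Swept.up_bwd hl's.2 hl's.1 hl'.le
  have hcont : Continuous fun l => tangentPt p θ (-l) :=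
    (continuous_tangentPt S.differentiable.continuous S.continuous_deriv).comp
      (by fun_prop : Continuous fun l : ℝ => (θ, -l))
  have hr0 : 0 < r := by
    refine (le_csInf ⟨l₀, hl₀s⟩ fun l hl => hl.1.le).lt_of_ne fun h => ?_
    have h0 : ∀ᶠ l in 𝓝 (0 : ℝ), tangentPt p θ (-l) ∈ Metric.thickening δ K :=
      hcont.continuousAt.eventually_mem (Metric.isOpen_thickening.mem_nhds
        (hKδ (by rw [neg_zero]; exact S.tangentPt_zero_mem θ)))
    obtain ⟨l, hl, hl0 : 0 < l⟩ :=
      ((h0.filter_mono nhdsWithin_le_nhds).and (self_mem_nhdsWithin (s := Set.Ioi (0 : ℝ)))).exists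
    exact hNδ _ (hrN' l (by rwa [hr, ← h])) hl
  have hrN : tangentPt p θ (-r) ∉ N := fun h => by
    have h0 : ∀ᶠ l in 𝓝 r, tangentPt p θ (-l) ∈ N :=
      hcont.continuousAt.eventually_mem (hNo.mem_nhds h)
    obtain ⟨l, hl, hl0, hlr⟩ :=
      ((h0.filter_mono nhdsWithin_le_nhds).and (Ioo_mem_nhdsLT hr0)).exists
    exact (csInf_le hsb ⟨hl0, hl⟩).not_gt hlr
  obtain ⟨a, ha1, ha2, -, har⟩ := S.exists_fwd_of_back (θ := θ) hr0
  obtain ⟨b, hb1, hb2, -, hbr⟩ := S.exists_back_of_fwd (θ := θ) hr0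
  have hαa : α < a := by
    by_contra! h
    have := S.backLen_anti ha1 h hα
    linarith
  have hbβ : b < β := by
    by_contra! h
    have := S.fwdLen_mono hβ h hb2
    linarith
  exact S.false_of_radial hNo hNb (fun φ l l' h hl hll' => Swept.up_bwd h hl hll')
    (fun φ l l' h hl hll' => Swept.up_fwd h hl hll') hNinv hd hr0 hrN hrN' ha2 hb1
    (by linarith) har hbr

/-- A compact convex body with differentiable support function and Lipschitz derivative. -/
theorem of_suppFn (hKcomp : IsCompact K) (hKconv : Convex ℝ K) (hKint : (interior K).Nonempty)
    (hp : ∀ θ : ℝ, p θ = suppFn K θ) (hpdiff : Differentiable ℝ p)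
    (hplip : ∃ L, LipschitzWith L (deriv p))
    (hback : ∀ z ∉ K, ∃ θ l : ℝ, ∃ a ∈ K, 0 < l ∧ a.1 * cos θ + a.2 * sin θ = p θ ∧
      z = a - l • ((-sin θ, cos θ) : ℝ × ℝ)) : SupportData K p := by
  have hc : ∀ θ, Continuous fun z : ℝ × ℝ => z.1 * cos θ + z.2 * sin θ := fun θ => by fun_prop
  have hle : ∀ k ∈ K, ∀ θ, k.1 * cos θ + k.2 * sin θ ≤ p θ := fun k hk θ => by
    rw [hp]
    exact le_csSup (hKcomp.image (hc θ)).bddAbove ⟨k, hk, rfl⟩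
  refine ⟨hKcomp, hKconv, hle, ?_, fun θ => ?_, hpdiff, hplip, fun θ => ?_, fun z hz => ?_⟩
  · obtain ⟨k, hk⟩ := hKint
    refine ⟨k, hk, fun θ => ?_⟩
    have h0 : ∀ᶠ t in 𝓝 (0 : ℝ), k + t • ((cos θ, sin θ) : ℝ × ℝ) ∈ K := by
      have : Continuous fun t : ℝ => k + t • ((cos θ, sin θ) : ℝ × ℝ) := by fun_prop
      exact this.continuousAt.eventually_mem (by simpa using mem_interior_iff_mem_nhds.1 hk)
    obtain ⟨t, ht, ht0 : 0 < t⟩ :=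
      ((h0.filter_mono nhdsWithin_le_nhds).and (self_mem_nhdsWithin (s := Set.Ioi (0 : ℝ)))).exists
    have := hle _ ht θ
    simp only [Prod.fst_add, Prod.snd_add, Prod.smul_fst, Prod.smul_snd, smul_eq_mul] at this
    nlinarith [sin_sq_add_cos_sq θ]
  · obtain ⟨k, hk, h⟩ := hKcomp.exists_sSup_image_eq (hKint.mono interior_subset)
      (hc θ).continuousOn
    exact ⟨k, hk, by rw [hp, suppFn, h]⟩
  · simp only [hp, suppFn, cos_add_two_pi, sin_add_two_pi]
  · obtain ⟨θ, l, a, ha, hl, h, rfl⟩ := hback z hz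
    refine ⟨θ, l, hl, ?_⟩
    rw [tangentPt_eq_add_smul, ← eq_tangentPt_of_isContact (hpdiff θ) (hle a ha) h, neg_smul,
      sub_eq_add_neg]

end SupportData

theorem stmt15
    (K : Set (ℝ × ℝ))
    (hKcomp : IsCompact K) (hKconv : Convex ℝ K) (hKstrict : StrictConvex ℝ K)
    (hKint : (interior K).Nonempty)
    (p : ℝ → ℝ) (hp : ∀ θ : ℝ, p θ = suppFn K θ)
    (hpdiff : Differentiable ℝ p)
    (hplip : ∃ L : NNReal, LipschitzWith L (deriv p))
    (Φ : ℝ × ℝ → ℝ × ℝ)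
    (hΦ : ∀ z : ℝ × ℝ, z ∉ K → ∃ θ l : ℝ, ∃ a : ℝ × ℝ, 0 < l ∧ a ∈ K ∧
      a.1 * Real.cos θ + a.2 * Real.sin θ = p θ ∧
      z = a - l • ((-Real.sin θ, Real.cos θ) : ℝ × ℝ) ∧
      Φ z = (2 : ℝ) • a - z)
    (c d : ℝ) (hcd : c < d) (hlen : d - c < 2 * π)
    (U : Set ℝ) (hUopen : IsOpen U) (hJU : Set.Icc c d ⊆ U)
    (hpC2 : ContDiffOn ℝ 2 p U)
    (hρcont : ContinuousOn (fun θ => p θ + deriv (deriv p) θ) U)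
    (hρc : 0 < p c + deriv (deriv p) c)
    (hρd : 0 < p d + deriv (deriv p) d)
    (θhat : ℝ) (hθhat : θhat ∈ Set.Ioo c d)
    (hρzero : p θhat + deriv (deriv p) θhat = 0) :
    ∃ ε : ℝ, 0 < ε ∧ ∀ Ω : Set (ℝ × ℝ), DBInvCircle K Φ Ω →
      ¬ (Ω ⊆ {z : ℝ × ℝ | z ∉ K ∧ Metric.infDist z K < ε}) := by
  have S : SupportData K p := .of_suppFn hKcomp hKconv hKint hp hpdiff hplip fun z hz => by
    obtain ⟨θ, l, a, hl, ha, h, hz, -⟩ := hΦ z hz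
    exact ⟨θ, l, a, ha, hl, h, hz⟩
  have hΦ' : ∀ θ l, 0 < l → Φ (tangentPt p θ (-l)) = tangentPt p θ l := by
    intro θ l hl
    obtain ⟨φ, m, a, hm, ha, h, hz, hΦz⟩ :=
      hΦ _ (S.tangentPt_notMem (θ := θ) (neg_ne_zero.2 hl.ne'))
    have ha0 := eq_tangentPt_of_isContact (hpdiff φ) (S.dot_le a ha) h
    have e : tangentPt p θ (-l) = tangentPt p φ (-m) := by
      rw [hz, ha0, tangentPt_eq_add_smul p φ (-m), neg_smul, sub_eq_add_neg]
    obtain ⟨hs, rfl⟩ := S.bwd_inj hl hm e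
    rw [hΦz, ha0, ← hs l, e, tangentPt_eq_add_smul p φ (-l), tangentPt_eq_add_smul p φ l]
    module
  have hmem : θhat ∈ U := hJU (Set.Ioo_subset_Icc_self hθhat)
  have hdd : DifferentiableAt ℝ (deriv p) θhat :=
    (((contDiffOn_succ_iff_deriv_of_isOpen (n := 1) hUopen).1 hpC2).2.2.differentiableOn
      one_ne_zero).differentiableAt (hUopen.mem_nhds hmem)
  exact S.exists_no_invCircle hΦ' (hdd.hasDerivAt.congr_deriv (by linarith))
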